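/- arXiv:2108.02227 — 2 statements merged into one kernel-verified Lean document; each statement's English description precedes it below -/
import Mathlib

section
/- Let a_n = p_n be the n-th prime. Let (η(N))_{N≥1} be a strictly decreasing sequence of non-negative reals such that there exists c > 0 with η(2N) ≥ c·η(N) for all N. Let 𝒜 = {α ∈ [0,1] : δ_min^α(N) ≤ η(N log N) for infinitely many N}. If the series Σ_{N=1}^∞ η(N) converges, then the Lebesgue measure of 𝒜 equals 0. -/
open MeasureTheory Filter

/-- Distance to the nearest integer. -/
noncomputable def nint (x : ℝ) : ℝ := |x - round x|

/-- `δ_min^α(N) = min { ‖(a_m - a_n) α‖ : 1 ≤ m, n ≤ N, m ≠ n }`. -/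
noncomputable def deltaMin (a : ℕ → ℕ) (α : ℝ) (N : ℕ) : ℝ :=
  sInf {x : ℝ | ∃ m n : ℕ, 1 ≤ m ∧ m ≤ N ∧ 1 ≤ n ∧ n ≤ N ∧ m ≠ n ∧
    x = nint (((a m : ℝ) - (a n : ℝ)) * α)}

/-- `C_N = #(A_N - A_N)` where `A_N = {a_1, …, a_N}`. -/
noncomputable def diffCard (a : ℕ → ℕ) (N : ℕ) : ℕ :=
  (((Finset.Icc 1 N) ×ˢ (Finset.Icc 1 N)).image
    (fun p : ℕ × ℕ => (a p.1 : ℤ) - (a p.2 : ℤ))).card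

/-- `log x`, read as `max {1, log x}`. -/
noncomputable def L (x : ℝ) : ℝ := max 1 (Real.log x)

/-- `log₂ x = log log x`, with the `max {1, ·}` convention. -/
noncomputable def LL (x : ℝ) : ℝ := L (L x)

/-- The `n`-th prime number (`nthPrime 1 = 2`). -/
noncomputable def nthPrime (n : ℕ) : ℕ := Nat.nth Nat.Prime (n - 1)

lemma nint_neg (x : ℝ) : nint (-x) = nint x := by
  unfold nint
  rw [← UnitAddCircle.norm_eq, ← UnitAddCircle.norm_eq]
  simp

lemma volume_nint_mul_le (d : ℕ) (hd : 1 ≤ d) (ε : ℝ) (hε : 0 ≤ ε) :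
    volume {α : ℝ | α ∈ Set.Icc (0 : ℝ) 1 ∧ nint (d * α) ≤ ε} ≤ ENNReal.ofReal (4 * ε) := by
  have hd' : (1 : ℝ) ≤ d := by exact_mod_cast hd
  have hsub : {α : ℝ | α ∈ Set.Icc (0 : ℝ) 1 ∧ nint (d * α) ≤ ε} ⊆
      ⋃ k ∈ Finset.range (d + 1), Set.Icc (((k : ℝ) - ε) / d) ((k + ε) / d) := by
    rintro α ⟨⟨h0, h1⟩, h⟩
    have hr0 : 0 ≤ round ((d : ℝ) * α) := by
      rw [round_eq]
      exact Int.floor_nonneg.2 (by positivity)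
    have hr1 : round ((d : ℝ) * α) ≤ d := by
      rw [round_eq, ← Int.lt_add_one_iff, Int.floor_lt]
      push_cast
      nlinarith
    obtain ⟨k, hk⟩ := Int.eq_ofNat_of_zero_le hr0
    have hk' : k < d + 1 := by omega
    simp only [Set.mem_iUnion, Finset.mem_range]
    refine ⟨k, hk', ?_⟩
    unfold nint at h
    rw [hk, Int.cast_natCast, abs_le] at h
    constructor
    · rw [div_le_iff₀ (by linarith)]; linarith
    · rw [le_div_iff₀ (by linarith)]; linarith
  calc _ ≤ _ := measure_mono hsub
    _ ≤ ∑ k ∈ Finset.range (d + 1), volume (Set.Icc (((k : ℝ) - ε) / d) ((k + ε) / d)) :=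
      measure_biUnion_finset_le _ _
    _ = ∑ k ∈ Finset.range (d + 1), ENNReal.ofReal (2 * ε / d) := by
      refine Finset.sum_congr rfl fun k _ => ?_
      rw [Real.volume_Icc]
      congr 1
      ring
    _ = ENNReal.ofReal ((d + 1) * (2 * ε / d)) := by
      rw [Finset.sum_const, Finset.card_range, nsmul_eq_mul, ENNReal.ofReal_mul (by positivity)]
      congr 1
      rw [← Nat.cast_add_one, ENNReal.ofReal_natCast]
    _ ≤ ENNReal.ofReal (4 * ε) := by
      apply ENNReal.ofReal_le_ofReal
      rw [mul_div_assoc', div_le_iff₀ (by linarith)]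
      nlinarith

lemma L_ge_one (x : ℝ) : 1 ≤ L x := le_max_left _ _

/-- A Chebyshev-type upper bound for the `N`-th prime. -/
lemma nthPrime_le (N : ℕ) (hN : 1 ≤ N) : nthPrime N ≤ 64 * ⌊(N : ℝ) * L N⌋₊ := by
  set q := nthPrime N with hq
  have hqp : q.Prime := Nat.prime_nth_prime _
  have hq2 : (2 : ℝ) ≤ q := by exact_mod_cast hqp.two_le
  have hN' : (1 : ℝ) ≤ N := by exact_mod_cast hN
  have hcount : Nat.primeCounting q = N := by
    rw [Nat.primeCounting, Nat.primeCounting', Nat.count_succ, if_pos hqp, hq, nthPrime]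
    have := Nat.primeCounting'_nth_eq (N - 1)
    rw [Nat.primeCounting'] at this
    rw [this]
    omega
  have h1 := (Chebyshev.psi_ge q).trans (Chebyshev.psi_le_primeCounting_mul_log q)
  rw [hcount] at h1
  have hlogq : 0 < Real.log q := Real.log_pos (by linarith)
  have h2 : Real.log (q + 1) ≤ 2 * Real.log q := by
    rw [show 2 * Real.log q = Real.log ((q : ℝ) ^ 2) by rw [Real.log_pow]; norm_num]
    exact Real.log_le_log (by linarith) (by nlinarith)
  have hlog2 : 0.6931 < Real.log 2 := by linarith [Real.log_two_gt_d9]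
  have h3 : 0.6931 * (q : ℝ) ≤ 3 * N * Real.log q := by nlinarith
  have h4 : Real.log q ≤ 2 * √q := by
    have hs := Real.log_le_sub_one_of_pos (x := √q) (Real.sqrt_pos.2 (by linarith))
    rw [Real.log_sqrt (by linarith)] at hs
    linarith
  have hs2 : √(q : ℝ) * √q = q := Real.mul_self_sqrt (by linarith)
  have hs0 : 0 < √(q : ℝ) := Real.sqrt_pos.2 (by linarith)
  have h5 : √(q : ℝ) ≤ 9 * N := by
    have : 0.6931 * √(q : ℝ) ≤ 6 * N := by
      refine le_of_mul_le_mul_right ?_ hs0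
      nlinarith
    linarith
  have h6 : Real.log q ≤ 7 * L N := by
    have : Real.log √(q : ℝ) ≤ Real.log (9 * N) := Real.log_le_log hs0 h5
    rw [Real.log_sqrt (by linarith), Real.log_mul (by norm_num) (by linarith)] at this
    have h9 : Real.log 9 ≤ 2.5 := by
      have : Real.log 9 ≤ Real.log (2 ^ (7 / 2 : ℝ)) := by
        apply Real.log_le_log (by norm_num)
        rw [show (7 / 2 : ℝ) = 3 + 1 / 2 by norm_num, Real.rpow_add (by norm_num),
          ← Real.sqrt_eq_rpow]
        have : (1.2 : ℝ) ≤ √2 := Real.le_sqrt_of_sq_le (by norm_num)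
        norm_num at this ⊢
        linarith
      rw [Real.log_rpow (by norm_num)] at this
      linarith [Real.log_two_lt_d9]
    have := L_ge_one N
    have : Real.log N ≤ L N := le_max_right _ _
    linarith
  have hNL : 1 ≤ (N : ℝ) * L N := by nlinarith [L_ge_one N]
  have h7 : (q : ℝ) ≤ 31 * (N * L N) := by
    have : (N : ℝ) * Real.log q ≤ N * (7 * L N) := by gcongr
    nlinarith
  have h8 : 1 ≤ ⌊(N : ℝ) * L N⌋₊ := Nat.one_le_floor_iff _ |>.2 hNL
  have h8' : (1 : ℝ) ≤ ⌊(N : ℝ) * L N⌋₊ := by exact_mod_cast h8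
  have h9 := Nat.lt_floor_add_one ((N : ℝ) * L N)
  have : (q : ℝ) ≤ 64 * ⌊(N : ℝ) * L N⌋₊ := by linarith
  exact_mod_cast this

lemma nthPrime_lt_nthPrime {m n : ℕ} (hm : 1 ≤ m) (hmn : m < n) : nthPrime m < nthPrime n :=
  Nat.nth_strictMono Nat.infinite_setOfPred_prime (by omega)

lemma nthPrime_monotone : Monotone nthPrime := fun _ _ h =>
  Nat.nth_monotone Nat.infinite_setOfPred_prime (by omega)

/-- The minimal gap is attained at a positive difference of primes. -/
lemma exists_deltaMin_nthPrime_eq (α : ℝ) (N : ℕ) (hN : 2 ≤ N) :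
    ∃ d : ℕ, 1 ≤ d ∧ d ≤ nthPrime N ∧ deltaMin nthPrime α N = nint (d * α) := by
  have hfin : {x : ℝ | ∃ m n : ℕ, 1 ≤ m ∧ m ≤ N ∧ 1 ≤ n ∧ n ≤ N ∧ m ≠ n ∧
      x = nint (((nthPrime m : ℝ) - (nthPrime n : ℝ)) * α)}.Finite := by
    refine ((Set.finite_Iic (N, N)).image
      (fun p : ℕ × ℕ => nint (((nthPrime p.1 : ℝ) - (nthPrime p.2 : ℝ)) * α))).subset ?_
    rintro x ⟨m, n, -, hm, -, hn, -, rfl⟩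
    exact ⟨(m, n), ⟨hm, hn⟩, rfl⟩
  have hne : {x : ℝ | ∃ m n : ℕ, 1 ≤ m ∧ m ≤ N ∧ 1 ≤ n ∧ n ≤ N ∧ m ≠ n ∧
      x = nint (((nthPrime m : ℝ) - (nthPrime n : ℝ)) * α)}.Nonempty :=
    ⟨_, 1, 2, le_rfl, by omega, by omega, hN, by omega, rfl⟩
  obtain ⟨m, n, hm1, hm, hn1, hn, hmn, h⟩ := hne.csInf_mem hfin
  have key : ∀ m n : ℕ, 1 ≤ m → n ≤ N → m < n →
      1 ≤ nthPrime n - nthPrime m ∧ nthPrime n - nthPrime m ≤ nthPrime N ∧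
      ((nthPrime n - nthPrime m : ℕ) : ℝ) = (nthPrime n : ℝ) - nthPrime m := by
    intro m n hm hn hmn
    have h1 := nthPrime_lt_nthPrime hm hmn
    have h2 := nthPrime_monotone hn
    exact ⟨by omega, by omega, Nat.cast_sub h1.le⟩
  rcases lt_or_gt_of_ne hmn with hlt | hlt
  · obtain ⟨h1, h2, h3⟩ := key m n hm1 hn hlt
    refine ⟨_, h1, h2, ?_⟩
    rw [h3, ← nint_neg, ← neg_mul, neg_sub]
    exact h
  · obtain ⟨h1, h2, h3⟩ := key n m hn1 hm hlt
    refine ⟨_, h1, h2, ?_⟩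
    rw [h3]
    exact h

lemma mul_pow_le_of_doubling {η : ℕ → ℝ} {c : ℝ} (hc : 0 ≤ c)
    (hreg : ∀ N : ℕ, 1 ≤ N → c * η N ≤ η (2 * N)) (k M : ℕ) (hM : 1 ≤ M) :
    c ^ k * η M ≤ η (2 ^ k * M) := by
  induction k with
  | zero => simp
  | succ k ih =>
    calc c ^ (k + 1) * η M = c * (c ^ k * η M) := by ring
      _ ≤ c * η (2 ^ k * M) := by gcongr
      _ ≤ η (2 * (2 ^ k * M)) := hreg _ (Nat.mul_pos (by positivity) hM)
      _ = η (2 ^ (k + 1) * M) := by rw [pow_succ']; ring_nf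

lemma tendsto_floor_mul_L : Tendsto (fun N : ℕ => ⌊(N : ℝ) * L N⌋₊) atTop atTop := by
  refine tendsto_atTop_mono (fun N => ?_) tendsto_id
  refine Nat.le_floor ?_
  simpa using le_mul_of_one_le_right (Nat.cast_nonneg N) (L_ge_one N)

theorem stmt6 (η : ℕ → ℝ) (hη : ∀ N, 0 ≤ η N)
    (hdec : ∀ m n : ℕ, 1 ≤ m → m < n → η n < η m)
    (c : ℝ) (hc : 0 < c) (hreg : ∀ N : ℕ, 1 ≤ N → c * η N ≤ η (2 * N))
    (hconv : Summable η) :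
    volume {α : ℝ | α ∈ Set.Icc (0 : ℝ) 1 ∧
      (∃ᶠ N in atTop, deltaMin nthPrime α N ≤ η ⌊(N : ℝ) * L N⌋₊)} = 0 := by
  set K : ℝ := (c ^ 6)⁻¹ with hK
  have hK0 : 0 < K := by positivity
  set S : ℕ → Set ℝ := fun d =>
    {α : ℝ | α ∈ Set.Icc (0 : ℝ) 1 ∧ nint ((d + 1 : ℕ) * α) ≤ K * η (d + 1)} with hS
  set Z : ℕ → Set ℝ := fun d =>
    {α : ℝ | α ∈ Set.Icc (0 : ℝ) 1 ∧ nint ((d + 1 : ℕ) * α) ≤ 0} with hZ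
  have hSnull : volume {α | ∃ᶠ d in atTop, α ∈ S d} = 0 := by
    apply measure_setOfPred_frequently_eq_zero
    have hsum : Summable fun d => 4 * (K * η (d + 1)) :=
      (((summable_nat_add_iff 1).2 hconv).mul_left K).mul_left 4
    refine ne_top_of_le_ne_top hsum.tsum_ofReal_ne_top (ENNReal.tsum_le_tsum fun d => ?_)
    exact volume_nint_mul_le (d + 1) (by omega) _ (mul_nonneg hK0.le (hη _))
  have hZnull : volume (⋃ d, Z d) = 0 := by
    refine measure_iUnion_null fun d => ?_
    have := volume_nint_mul_le (d + 1) (by omega) 0 le_rfl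
    exact le_antisymm (this.trans (by simp)) zero_le
  refine measure_mono_null ?_ (measure_union_null hSnull hZnull)
  rintro α ⟨hα, hfreq⟩
  by_contra hcon
  simp only [Set.mem_union, Set.mem_iUnion, Set.mem_ofPred_eq, not_or, not_exists,
    not_frequently, eventually_atTop] at hcon
  obtain ⟨⟨D, hD⟩, hpos⟩ := hcon
  have hη0 : Tendsto (fun N : ℕ => η ⌊(N : ℝ) * L N⌋₊) atTop (nhds 0) :=
    hconv.tendsto_atTop_zero.comp tendsto_floor_mul_L
  have hsmall : ∀ᶠ N : ℕ in atTop, ∀ d ∈ Finset.range D,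
      η ⌊(N : ℝ) * L N⌋₊ < nint ((d + 1 : ℕ) * α) := by
    rw [Filter.eventually_all_finset]
    intro d _
    refine hη0.eventually_lt_const ?_
    by_contra hle
    exact hpos d ⟨hα, not_lt.1 hle⟩
  obtain ⟨N, hN, hNsmall, hN2⟩ := (hfreq.and_eventually
    (hsmall.and (eventually_ge_atTop 2))).exists
  obtain ⟨d, hd1, hdN, hd⟩ := exists_deltaMin_nthPrime_eq α N hN2
  obtain ⟨e, rfl⟩ : ∃ e, d = e + 1 := ⟨d - 1, by omega⟩
  rw [hd] at hN
  have hbound := hdN.trans (nthPrime_le N (by omega))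
  set M := ⌊(N : ℝ) * L N⌋₊
  have hM : 1 ≤ M := by omega
  rcases lt_or_ge e D with he | he
  · exact absurd hN (not_le.2 (hNsmall e (Finset.mem_range.2 he)))
  · refine hD e he ⟨hα, hN.trans ?_⟩
    have h1 := mul_pow_le_of_doubling hc.le hreg 6 M hM
    have h2 : η (2 ^ 6 * M) ≤ η (e + 1) := by
      rcases hbound.lt_or_eq with h | h
      · exact (hdec _ _ hd1 (by omega)).le
      · rw [h]; norm_num
    rw [hK, ← div_eq_inv_mul, le_div_iff₀ (by positivity)]
    linarith
end

section
/- Let a_n = p_n be the n-th prime. Let (η(N))_{N≥1} be a strictly decreasing sequence of non-negative reals such that there exists c > 0 with η(2N) ≥ c·η(N) for all N. Let 𝒜 = {α ∈ [0,1] : δ_min^α(N) ≤ η(N log N) for infinitely many N}. If the series Σ_{N=1}^∞ η(N) diverges, then the Lebesgue measure of 𝒜 equals 1. -/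
open MeasureTheory Filter

theorem sq_sum_measureReal_le {Ω ι : Type*} [MeasurableSpace Ω] (μ : Measure Ω)
    (s : Finset ι) (B : ι → Set Ω) (hB : ∀ i ∈ s, MeasurableSet (B i))
    (hfin : ∀ i ∈ s, μ (B i) ≠ ⊤) :
    (∑ i ∈ s, μ.real (B i)) ^ 2 ≤
      μ.real (⋃ i ∈ s, B i) * ∑ i ∈ s, ∑ j ∈ s, μ.real (B i ∩ B j) := by
  classical
  set U := ⋃ i ∈ s, B i with hU
  have hUm : MeasurableSet U := s.measurableSet_biUnion hB
  have hUfin : μ U ≠ ⊤ := by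
    refine ne_of_lt ((measure_biUnion_finset_le s B).trans_lt ?_)
    exact ENNReal.sum_lt_top.2 fun i hi => (hfin i hi).lt_top
  have key : ∀ t : ℝ, 0 ≤ μ.real U * (t * t) + (-2 * ∑ i ∈ s, μ.real (B i)) * t
      + ∑ i ∈ s, ∑ j ∈ s, μ.real (B i ∩ B j) := by
    intro t
    have hi1 : ∀ A : Set Ω, MeasurableSet A → μ A ≠ ⊤ →
        Integrable (A.indicator (fun _ => (1 : ℝ))) μ := fun A hA hAf =>
      (integrable_indicator_iff hA).2 (integrableOn_const hAf)
    have hint : ∀ A : Set Ω, MeasurableSet A →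
        ∫ x, A.indicator (fun _ => (1 : ℝ)) x ∂μ = μ.real A := fun A hA => by
      rw [integral_indicator hA]; simp
    have e : ∀ x, (∑ i ∈ s, (B i).indicator (fun _ => (1 : ℝ)) x
          - t * U.indicator (fun _ => (1 : ℝ)) x) ^ 2
        = t * t * U.indicator (fun _ => (1 : ℝ)) x
          + (-2 * t) * (∑ i ∈ s, (B i).indicator (fun _ => (1 : ℝ)) x)
          + ∑ i ∈ s, ∑ j ∈ s, (B i ∩ B j).indicator (fun _ => (1 : ℝ)) x := by
      intro x
      have h1 : ∑ i ∈ s, ∑ j ∈ s, (B i ∩ B j).indicator (fun _ => (1 : ℝ)) x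
          = (∑ i ∈ s, (B i).indicator (fun _ => (1 : ℝ)) x) ^ 2 := by
        rw [sq, Finset.sum_mul_sum]
        refine Finset.sum_congr rfl fun i _ => Finset.sum_congr rfl fun j _ => ?_
        by_cases hi : x ∈ B i <;> by_cases hj : x ∈ B j <;> simp [hi, hj]
      rw [h1]
      by_cases hx : x ∈ U
      · rw [Set.indicator_of_mem hx]; ring
      · have h0 : ∑ i ∈ s, (B i).indicator (fun _ => (1 : ℝ)) x = 0 := by
          refine Finset.sum_eq_zero fun i hi => Set.indicator_of_notMem (fun h => hx ?_) _
          exact Set.mem_biUnion hi h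
        rw [h0, Set.indicator_of_notMem hx]; ring
    have hij : ∀ i ∈ s, ∀ j ∈ s, Integrable ((B i ∩ B j).indicator (fun _ => (1 : ℝ))) μ :=
      fun i hi j hj => hi1 _ ((hB i hi).inter (hB j hj))
        (ne_of_lt ((measure_mono Set.inter_subset_left).trans_lt (hfin i hi).lt_top))
    have h : 0 ≤ ∫ x, (∑ i ∈ s, (B i).indicator (fun _ => (1 : ℝ)) x
          - t * U.indicator (fun _ => (1 : ℝ)) x) ^ 2 ∂μ := integral_nonneg fun x => sq_nonneg _
    simp_rw [e] at h
    have I1 : Integrable (fun x => t * t * U.indicator (fun _ => (1 : ℝ)) x) μ :=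
      (hi1 U hUm hUfin).const_mul _
    have I2 : Integrable (fun x => (-2 * t) * ∑ i ∈ s, (B i).indicator (fun _ => (1 : ℝ)) x) μ :=
      (integrable_finsetSum s fun i hi => hi1 _ (hB i hi) (hfin i hi)).const_mul _
    have I3 : Integrable
        (fun x => ∑ i ∈ s, ∑ j ∈ s, (B i ∩ B j).indicator (fun _ => (1 : ℝ)) x) μ :=
      integrable_finsetSum s fun i hi => integrable_finsetSum s fun j hj => hij i hi j hj
    rw [integral_add (f := fun x => _ + _) (I1.add I2) I3, integral_add I1 I2,
      integral_const_mul, integral_const_mul,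
      hint U hUm, integral_finsetSum s fun i hi => hi1 _ (hB i hi) (hfin i hi),
      integral_finsetSum s fun i hi => integrable_finsetSum s fun j hj => hij i hi j hj] at h
    have h2 : ∑ i ∈ s, ∫ x, (B i).indicator (fun _ => (1 : ℝ)) x ∂μ = ∑ i ∈ s, μ.real (B i) :=
      Finset.sum_congr rfl fun i hi => hint _ (hB i hi)
    have h3 : ∑ i ∈ s, ∫ x, ∑ j ∈ s, (B i ∩ B j).indicator (fun _ => (1 : ℝ)) x ∂μ
        = ∑ i ∈ s, ∑ j ∈ s, μ.real (B i ∩ B j) := by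
      refine Finset.sum_congr rfl fun i hi => ?_
      rw [integral_finsetSum s fun j hj => hij i hi j hj]
      exact Finset.sum_congr rfl fun j hj => hint _ ((hB i hi).inter (hB j hj))
    rw [h2, h3] at h
    linarith
  have := discrim_le_zero key
  unfold discrim at this
  nlinarith

theorem card_filter_abs_sub_lt_le {q r : ℕ} (hq : 0 < q) (hr : 0 < r) (hqr : q ≠ r) {Δ : ℝ}
    (hΔ : 0 ≤ Δ) :
    ((((Finset.Icc 1 q).filter (Nat.Coprime q) ×ˢ (Finset.Icc 1 r).filter (Nat.Coprime r)).filter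
      (fun x : ℕ × ℕ => |(x.1 : ℝ) / q - (x.2 : ℝ) / r| < Δ)).card : ℝ) ≤ 2 * Δ * q * r := by
  set S := ((Finset.Icc 1 q).filter (Nat.Coprime q) ×ˢ
    (Finset.Icc 1 r).filter (Nat.Coprime r)).filter
      (fun x : ℕ × ℕ => |(x.1 : ℝ) / q - (x.2 : ℝ) / r| < Δ) with hS
  obtain ⟨g, q', r', hg, hcop, rfl, rfl⟩ := Nat.exists_coprime' (m := q) (n := r)
    (Nat.gcd_pos_of_pos_left _ hq)
  have hq' : 0 < q' := Nat.pos_of_mul_pos_right hq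
  have hr' : 0 < r' := Nat.pos_of_mul_pos_right hr
  have hgR : (0 : ℝ) < g := by exact_mod_cast hg
  have hq'R : (0 : ℝ) < q' := by exact_mod_cast hq'
  have hr'R : (0 : ℝ) < r' := by exact_mod_cast hr'
  let f : ℕ × ℕ → ℤ := fun x => (x.1 : ℤ) * r' - x.2 * q'
  set T : ℝ := Δ * g * q' * r' with hT
  have hT0 : 0 ≤ T := by positivity
  have himg : S.image f ⊆ (Finset.Icc (-(⌊T⌋₊ : ℤ)) ⌊T⌋₊).erase 0 := by
    intro t ht
    obtain ⟨⟨a, b⟩, hab, rfl⟩ := Finset.mem_image.1 ht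
    simp only [hS, Finset.mem_filter, Finset.mem_product, Finset.mem_Icc] at hab
    obtain ⟨⟨⟨⟨ha1, ha2⟩, ha⟩, ⟨hb1, hb2⟩, hb⟩, hlt⟩ := hab
    have h1 : |((f (a, b) : ℤ) : ℝ)| < T := by
      have : (a : ℝ) / ((q' * g : ℕ) : ℝ) - (b : ℝ) / ((r' * g : ℕ) : ℝ)
          = ((f (a, b) : ℤ) : ℝ) / (g * q' * r') := by
        simp only [f]; push_cast; field_simp
      rw [this, abs_div, abs_of_pos (by positivity : (0 : ℝ) < g * q' * r'),
        div_lt_iff₀ (by positivity)] at hlt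
      rw [hT]; linarith
    rw [Finset.mem_erase, Finset.mem_Icc]
    constructor
    · intro h0
      simp only [f] at h0
      have h0' : a * r' = b * q' := by zify; linarith
      have e1 : q' * g ∣ r' * g := by
        have : q' * g ∣ a * (r' * g) := ⟨b, by rw [← mul_assoc, h0']; ring⟩
        exact ha.dvd_of_dvd_mul_left this
      have e2 : r' * g ∣ q' * g := by
        have : r' * g ∣ b * (q' * g) := ⟨a, by rw [← mul_assoc, ← h0']; ring⟩
        exact hb.dvd_of_dvd_mul_left this
      exact hqr (Nat.dvd_antisymm e1 e2)
    · have h2 : (f (a, b)).natAbs ≤ ⌊T⌋₊ := by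
        apply Nat.le_floor
        rw [Nat.cast_natAbs, Int.cast_abs]; exact h1.le
      omega
  have hfib : ∀ t ∈ S.image f, (S.filter fun x => f x = t).card ≤ g := by
    intro t ht
    obtain ⟨⟨a, b⟩, hab, rfl⟩ := Finset.mem_image.1 ht
    have hmod : ∀ x ∈ S.filter (fun x => f x = f (a, b)), x.1 ≡ a [MOD q'] := by
      rintro ⟨a', b'⟩ hx
      have hx := (Finset.mem_filter.1 hx).2
      simp only [f] at hx
      have : (q' : ℤ) ∣ ((a : ℤ) - a') * r' := ⟨b - b', by linarith⟩
      have h3 : (q' : ℤ) ∣ (a : ℤ) - a' :=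
        IsCoprime.dvd_of_dvd_mul_right (Nat.isCoprime_iff_coprime.2 hcop) this
      exact (Nat.modEq_iff_dvd.2 h3)
    have hinj : Set.InjOn (fun x : ℕ × ℕ => x.1) (S.filter (fun x => f x = f (a, b))) := by
      rintro ⟨a1, b1⟩ h1 ⟨a2, b2⟩ h2 h12
      have h1 := (Finset.mem_filter.1 h1).2
      have h2 := (Finset.mem_filter.1 h2).2
      simp only at h12
      subst h12
      simp only [f] at h1 h2
      have : (b1 : ℤ) * q' = b2 * q' := by linarith
      have := mul_right_cancel₀ (by exact_mod_cast hq'.ne') this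
      simpa using this
    rw [← Finset.card_image_of_injOn hinj]
    calc _ ≤ ((Finset.Ioc 0 (q' * g)).filter (fun x => x ≡ a [MOD q'])).card := by
          apply Finset.card_le_card
          intro y hy
          obtain ⟨x, hx, rfl⟩ := Finset.mem_image.1 hy
          refine Finset.mem_filter.2 ⟨?_, hmod x hx⟩
          have := (Finset.mem_filter.1 hx).1
          simp only [hS, Finset.mem_filter, Finset.mem_product, Finset.mem_Icc] at this
          simp only [Finset.mem_Ioc]
          omega
      _ ≤ g := by
          have h := Nat.Ioc_filter_modEq_card 0 (q' * g) hq' a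
          have e : ((q' * g : ℕ) - (a : ℚ)) / (q' : ℚ) =
              ((0 : ℕ) - (a : ℚ)) / (q' : ℚ) + (g : ℕ) := by
            have : (q' : ℚ) ≠ 0 := by exact_mod_cast hq'.ne'
            push_cast; field_simp; ring
          rw [e, Int.floor_add_natCast] at h
          omega
  have hcard := Finset.card_le_mul_card_image (f := f) S g hfib
  have h1 : (S.image f).card ≤ 2 * ⌊T⌋₊ := by
    refine (Finset.card_le_card himg).trans ?_
    rw [Finset.card_erase_of_mem (by simp), Int.card_Icc]
    omega
  have h2 : (⌊T⌋₊ : ℝ) ≤ T := Nat.floor_le hT0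
  calc (S.card : ℝ) ≤ ((g * (2 * ⌊T⌋₊) : ℕ) : ℝ) := by
        exact_mod_cast hcard.trans (Nat.mul_le_mul_left _ h1)
    _ ≤ g * (2 * T) := by push_cast; gcongr
    _ = _ := by rw [hT]; push_cast; ring

/-- The reduced residues modulo `q`. -/
def reducedResidues (q : ℕ) : Finset ℕ := (Finset.range q).filter (Nat.Coprime q)

theorem mem_reducedResidues {q a : ℕ} (hq : 2 ≤ q) (ha : a ∈ reducedResidues q) :
    1 ≤ a ∧ a + 1 ≤ q ∧ q.Coprime a := by
  obtain ⟨h1, h2⟩ := Finset.mem_filter.1 ha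
  rw [Finset.mem_range] at h1
  refine ⟨Nat.pos_of_ne_zero ?_, h1, h2⟩
  rintro rfl
  rw [Nat.coprime_zero_right] at h2
  omega

theorem ball_inter_ball_eq_empty {x y δ ε : ℝ} (h : δ + ε ≤ |x - y|) :
    Metric.ball x δ ∩ Metric.ball y ε = ∅ :=
  Set.disjoint_iff_inter_eq_empty.1 (Metric.ball_disjoint_ball (by rwa [Real.dist_eq]))

theorem sum_measureReal_ball_inter_le {q r : ℕ} (hq : 2 ≤ q) (hr : 2 ≤ r) (hqr : q ≠ r)
    {x y : ℝ} (hx : 0 ≤ x) (hy : 0 ≤ y) :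
    ∑ a ∈ reducedResidues q, ∑ b ∈ reducedResidues r,
      volume.real (Metric.ball ((a : ℝ) / q) (x / q) ∩ Metric.ball ((b : ℝ) / r) (y / r))
      ≤ 8 * x * y := by
  have hqR : (0 : ℝ) < q := by positivity
  have hrR : (0 : ℝ) < r := by positivity
  set Δ := x / q + y / r with hΔ
  have hΔ0 : 0 ≤ Δ := by positivity
  have hm0 : 0 ≤ min (x / q) (y / r) := le_min (by positivity) (by positivity)
  have hball : ∀ z d : ℝ, 0 ≤ d → volume.real (Metric.ball z d) = 2 * d := fun z d hd => by
    rw [Measure.real, Real.volume_ball, ENNReal.toReal_ofReal (by positivity)]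
  have hterm : ∀ z w : ℝ, volume.real (Metric.ball z (x / q) ∩ Metric.ball w (y / r))
      ≤ if |z - w| < Δ then 2 * min (x / q) (y / r) else 0 := by
    intro z w
    split_ifs with h
    · rw [mul_min_of_nonneg _ _ (by norm_num : (0 : ℝ) ≤ 2)]
      refine le_min ?_ ?_
      · rw [← hball z (x / q) (by positivity)]
        exact measureReal_mono Set.inter_subset_left measure_ball_lt_top.ne
      · rw [← hball w (y / r) (by positivity)]
        exact measureReal_mono Set.inter_subset_right measure_ball_lt_top.ne
    · rw [ball_inter_ball_eq_empty (not_lt.1 h)]; simp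
  calc _ ≤ ∑ a ∈ reducedResidues q, ∑ b ∈ reducedResidues r,
        (if |(a : ℝ) / q - (b : ℝ) / r| < Δ then 2 * min (x / q) (y / r) else 0) :=
        Finset.sum_le_sum fun a _ => Finset.sum_le_sum fun b _ => hterm _ _
    _ = (((reducedResidues q ×ˢ reducedResidues r).filter
        (fun x : ℕ × ℕ => |(x.1 : ℝ) / q - (x.2 : ℝ) / r| < Δ)).card : ℝ)
          * (2 * min (x / q) (y / r)) := by
        rw [← Finset.sum_product', ← Finset.sum_filter, Finset.sum_const, nsmul_eq_mul]
    _ ≤ (2 * Δ * q * r) * (2 * min (x / q) (y / r)) := by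
        gcongr
        refine le_trans ?_ (card_filter_abs_sub_lt_le (by omega) (by omega) hqr hΔ0)
        have hsub : ∀ {q : ℕ}, 2 ≤ q →
            reducedResidues q ⊆ (Finset.Icc 1 q).filter (Nat.Coprime q) := by
          intro q hq a ha
          have := mem_reducedResidues hq ha
          simp only [Finset.mem_filter, Finset.mem_Icc]
          exact ⟨by omega, this.2.2⟩
        exact_mod_cast Finset.card_le_card
          (Finset.filter_subset_filter _ (Finset.product_subset_product (hsub hq) (hsub hr)))
    _ ≤ _ := by
        have h1 : (x / q + y / r) * min (x / q) (y / r) ≤ 2 * (x / q) * (y / r) := by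
          have ha : 0 ≤ x / q := by positivity
          have hb : 0 ≤ y / r := by positivity
          rcases le_total (x / q) (y / r) with h | h
          · rw [min_eq_left h]; nlinarith
          · rw [min_eq_right h]; nlinarith
        calc _ = 4 * q * r * ((x / q + y / r) * min (x / q) (y / r)) := by rw [hΔ]; ring
          _ ≤ 4 * q * r * (2 * (x / q) * (y / r)) := by gcongr
          _ = _ := by field_simp; ring

theorem sum_measureReal_ball_inter_self {q : ℕ} (hq : 2 ≤ q) {x : ℝ} (hx' : x ≤ 1 / 2) :
    ∑ a ∈ reducedResidues q, ∑ b ∈ reducedResidues q,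
      volume.real (Metric.ball ((a : ℝ) / q) (x / q) ∩ Metric.ball ((b : ℝ) / q) (x / q))
      = ∑ a ∈ reducedResidues q, volume.real (Metric.ball ((a : ℝ) / q) (x / q)) := by
  have hqR : (0 : ℝ) < q := by positivity
  refine Finset.sum_congr rfl fun a ha => ?_
  rw [Finset.sum_eq_single_of_mem a ha]
  · rw [Set.inter_self]
  intro b _ hb
  rw [ball_inter_ball_eq_empty]
  · simp
  · rw [← sub_div, abs_div, abs_of_pos hqR, ← add_div]
    gcongr
    have : (1 : ℝ) ≤ |(a : ℝ) - b| := by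
      have h : (1 : ℤ) ≤ |(a : ℤ) - b| := Int.one_le_abs (by omega)
      exact_mod_cast h
    linarith

/-- The points within `ψ q / q` of some reduced fraction with denominator `q`. -/
def nearReduced (ψ : ℕ → ℝ) (q : ℕ) : Set ℝ :=
  ⋃ a ∈ reducedResidues q, Metric.ball ((a : ℝ) / q) (ψ q / q)

theorem le_measureReal_biUnion_nearReduced {ψ : ℕ → ℝ} (h0 : ∀ q, 0 ≤ ψ q)
    (h1 : ∀ q, ψ q ≤ 1 / 2) {κ : ℝ} (hκ : 0 < κ)
    (hφ : ∀ q, ψ q ≠ 0 → κ * q ≤ Nat.totient q) {n Q : ℕ} (hn : 2 ≤ n)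
    (hsum : 1 ≤ 2 * κ * ∑ q ∈ Finset.Icc n Q, ψ q) :
    κ ^ 2 / (κ ^ 2 + 2) ≤ volume.real (⋃ q ∈ Finset.Icc n Q, nearReduced ψ q) := by
  set S := ∑ q ∈ Finset.Icc n Q, ψ q with hS
  have hball : ∀ z d : ℝ, 0 ≤ d → volume.real (Metric.ball z d) = 2 * d := fun z d hd => by
    rw [Measure.real, Real.volume_ball, ENNReal.toReal_ofReal (by positivity)]
  let s : Finset (Σ _ : ℕ, ℕ) := (Finset.Icc n Q).sigma fun q => reducedResidues q
  let B : (Σ _ : ℕ, ℕ) → Set ℝ := fun i => Metric.ball ((i.2 : ℝ) / i.1) (ψ i.1 / i.1)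
  have hU : (⋃ i ∈ s, B i) = ⋃ q ∈ Finset.Icc n Q, nearReduced ψ q := by
    ext x
    simp only [s, B, nearReduced, Set.mem_iUnion, Finset.mem_sigma, Sigma.exists, exists_prop]
    constructor
    · rintro ⟨q, a, ⟨h1, h2⟩, h3⟩; exact ⟨q, h1, a, h2, h3⟩
    · rintro ⟨q, h1, a, h2, h3⟩; exact ⟨q, a, ⟨h1, h2⟩, h3⟩
  have key := sq_sum_measureReal_le volume s B (fun i _ => measurableSet_ball)
    (fun i _ => measure_ball_lt_top.ne)
  rw [hU] at key
  set V := volume.real (⋃ q ∈ Finset.Icc n Q, nearReduced ψ q) with hV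
  set M := ∑ i ∈ s, volume.real (B i) with hM
  have hMS : 2 * κ * S ≤ M := by
    rw [hM, Finset.sum_sigma, hS, Finset.mul_sum]
    refine Finset.sum_le_sum fun q hq => ?_
    have hq2 : 2 ≤ q := hn.trans (Finset.mem_Icc.1 hq).1
    have hqR : (0 : ℝ) < q := by positivity
    have : ∑ a ∈ reducedResidues q, volume.real (B ⟨q, a⟩) = Nat.totient q * (2 * (ψ q / q)) := by
      rw [Finset.sum_congr rfl fun a _ => hball _ _ (div_nonneg (h0 q) hqR.le), Finset.sum_const,
        nsmul_eq_mul]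
      rfl
    rw [this]
    by_cases hz : ψ q = 0
    · simp [hz]
    · have := hφ q hz
      calc 2 * κ * ψ q = (κ * q) * (2 * (ψ q / q)) := by field_simp
        _ ≤ _ := by
          have := h0 q
          gcongr
  have hdouble : ∑ i ∈ s, ∑ j ∈ s, volume.real (B i ∩ B j) ≤ M + 8 * S ^ 2 := by
    have e : ∑ i ∈ s, ∑ j ∈ s, volume.real (B i ∩ B j) = ∑ q ∈ Finset.Icc n Q,
        ∑ r ∈ Finset.Icc n Q, ∑ a ∈ reducedResidues q, ∑ b ∈ reducedResidues r,
          volume.real (B ⟨q, a⟩ ∩ B ⟨r, b⟩) := by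
      rw [Finset.sum_sigma]
      refine Finset.sum_congr rfl fun q _ => ?_
      exact (Finset.sum_congr rfl fun a _ => Finset.sum_sigma _ _ _).trans Finset.sum_comm
    rw [e, hM, Finset.sum_sigma, hS, sq, Finset.sum_mul_sum, Finset.mul_sum,
      ← Finset.sum_add_distrib]
    refine Finset.sum_le_sum fun q hq => ?_
    have hq2 : 2 ≤ q := le_trans hn (Finset.mem_Icc.1 hq).1
    rw [← Finset.add_sum_erase _ _ hq]
    refine add_le_add (sum_measureReal_ball_inter_self hq2 (h1 q)).le ?_
    have hoff : ∀ r ∈ (Finset.Icc n Q).erase q,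
        ∑ a ∈ reducedResidues q, ∑ b ∈ reducedResidues r, volume.real (B ⟨q, a⟩ ∩ B ⟨r, b⟩)
          ≤ 8 * (ψ q * ψ r) := by
      intro r hr
      obtain ⟨hrq, hr⟩ := Finset.mem_erase.1 hr
      have hr2 : 2 ≤ r := hn.trans (Finset.mem_Icc.1 hr).1
      have := sum_measureReal_ball_inter_le hq2 hr2 hrq.symm (h0 q) (h0 r)
      rwa [mul_assoc] at this
    refine (Finset.sum_le_sum hoff).trans ?_
    rw [← Finset.mul_sum]
    refine mul_le_mul_of_nonneg_left ?_ (by norm_num)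
    exact Finset.sum_le_sum_of_subset_of_nonneg (Finset.erase_subset _ _)
      fun r _ _ => mul_nonneg (h0 q) (h0 r)
  have hV0 : 0 ≤ V := measureReal_nonneg
  have hM1 : 1 ≤ M := hsum.trans hMS
  have hS0 : 0 ≤ S := Finset.sum_nonneg fun q _ => h0 q
  have h2 : M ^ 2 ≤ V * (M + 8 * S ^ 2) := key.trans (by gcongr)
  have h3 : κ ^ 2 * (8 * S ^ 2) ≤ 2 * M ^ 2 := by
    have : (2 * κ * S) ^ 2 ≤ M ^ 2 := by gcongr
    nlinarith
  have h4 : κ ^ 2 * (M + 8 * S ^ 2) ≤ (κ ^ 2 + 2) * M ^ 2 := by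
    have : κ ^ 2 * M ≤ κ ^ 2 * M ^ 2 :=
      mul_le_mul_of_nonneg_left (by nlinarith) (sq_nonneg κ)
    linarith
  rw [div_le_iff₀ (by positivity)]
  have h5 : κ ^ 2 * M ^ 2 ≤ V * (κ ^ 2 + 2) * M ^ 2 := by
    calc κ ^ 2 * M ^ 2 ≤ κ ^ 2 * (V * (M + 8 * S ^ 2)) := by gcongr
      _ = V * (κ ^ 2 * (M + 8 * S ^ 2)) := by ring
      _ ≤ V * ((κ ^ 2 + 2) * M ^ 2) := by gcongr
      _ = _ := by ring
  exact le_of_mul_le_mul_right h5 (by positivity)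

theorem nearReduced_subset_Ioo {ψ : ℕ → ℝ} (h1 : ∀ q, ψ q ≤ 1 / 2) {q : ℕ} (hq : 2 ≤ q) :
    nearReduced ψ q ⊆ Set.Ioo 0 1 := by
  intro x hx
  simp only [nearReduced, Set.mem_iUnion, exists_prop] at hx
  obtain ⟨a, ha, hx⟩ := hx
  obtain ⟨ha1, ha2, -⟩ := mem_reducedResidues hq ha
  have ha1 : (1 : ℝ) ≤ a := by exact_mod_cast ha1
  have ha2 : (a : ℝ) + 1 ≤ q := by exact_mod_cast ha2
  have hqR : (0 : ℝ) < q := by positivity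
  rw [Metric.mem_ball, Real.dist_eq, abs_lt] at hx
  obtain ⟨hx1, hx2⟩ := hx
  have := h1 q
  constructor
  · have : 0 ≤ (a : ℝ) / q - ψ q / q := by rw [← sub_div]; apply div_nonneg <;> linarith
    linarith
  · have : (a : ℝ) / q + ψ q / q ≤ 1 := by rw [← add_div, div_le_one hqR]; linarith
    linarith

theorem isOpen_nearReduced (ψ : ℕ → ℝ) (q : ℕ) : IsOpen (nearReduced ψ q) :=
  isOpen_biUnion fun _ _ => Metric.isOpen_ball

theorem volume_frequently_nearReduced_pos {ψ : ℕ → ℝ} (h0 : ∀ q, 0 ≤ ψ q)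
    (h1 : ∀ q, ψ q ≤ 1 / 2) (hdiv : ¬ Summable ψ) {κ : ℝ} (hκ : 0 < κ)
    (hφ : ∀ q, ψ q ≠ 0 → κ * q ≤ Nat.totient q) :
    0 < volume (⋂ n : ℕ, ⋃ q ≥ n + 2, nearReduced ψ q) := by
  set U : ℕ → Set ℝ := fun n => ⋃ q ≥ n + 2, nearReduced ψ q with hU
  have hsub : ∀ n, U n ⊆ Set.Ioo 0 1 := fun n => Set.iUnion₂_subset fun q hq =>
    nearReduced_subset_Ioo h1 (le_trans (Nat.le_add_left _ _) hq)
  have hmeas : ∀ n, MeasurableSet (U n) := fun n =>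
    (isOpen_biUnion fun q _ => isOpen_nearReduced ψ q).measurableSet
  have hfin : ∀ n, volume (U n) ≠ ⊤ := fun n =>
    ne_of_lt ((measure_mono (hsub n)).trans_lt (by simp))
  have hanti : Antitone U := fun m n hmn =>
    Set.biUnion_subset_biUnion_left fun q (hq : n + 2 ≤ q) => show m + 2 ≤ q by omega
  have hlow : ∀ n, ENNReal.ofReal (κ ^ 2 / (κ ^ 2 + 2)) ≤ volume (U n) := by
    intro n
    have hdiv' : Tendsto (fun Q => ∑ q ∈ Finset.range Q, ψ q) atTop atTop :=
      (not_summable_iff_tendsto_nat_atTop_of_nonneg h0).1 hdiv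
    obtain ⟨Q, hQ1, hQ2⟩ := ((hdiv'.eventually_ge_atTop
      (∑ q ∈ Finset.range (n + 2), ψ q + 1 / (2 * κ))).and (eventually_ge_atTop (n + 2))).exists
    have hs : 1 ≤ 2 * κ * ∑ q ∈ Finset.Icc (n + 2) Q, ψ q := by
      have h2 : ∑ q ∈ Finset.range Q, ψ q ≤
          ∑ q ∈ Finset.range (n + 2), ψ q + ∑ q ∈ Finset.Icc (n + 2) Q, ψ q := by
        rw [← Finset.sum_range_add_sum_Ico ψ hQ2]
        refine add_le_add le_rfl ?_
        exact Finset.sum_le_sum_of_subset_of_nonneg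
          (fun x hx => Finset.mem_Icc.2 ⟨(Finset.mem_Ico.1 hx).1, (Finset.mem_Ico.1 hx).2.le⟩)
          fun q _ _ => h0 q
      have h3 : 1 / (2 * κ) ≤ ∑ q ∈ Finset.Icc (n + 2) Q, ψ q := by linarith
      rw [div_le_iff₀ (by positivity)] at h3
      linarith
    have h4 := le_measureReal_biUnion_nearReduced h0 h1 hκ hφ (by omega) hs
    refine (ENNReal.ofReal_le_ofReal h4).trans ?_
    rw [Measure.real]
    refine ENNReal.ofReal_toReal_le.trans (measure_mono ?_)
    exact Set.biUnion_subset_biUnion_left fun q hq => (Finset.mem_Icc.1 hq).1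
  have hlim := tendsto_measure_iInter_atTop (fun n => (hmeas n).nullMeasurableSet) hanti
    ⟨0, hfin 0⟩
  refine lt_of_lt_of_le ?_ (ge_of_tendsto' hlim hlow)
  rw [ENNReal.ofReal_pos]
  positivity

/-- A form of the Duffin-Schaeffer theorem for denominators with `φ(q) ≫ q`. -/
theorem ae_frequently_nint_lt {ψ : ℕ → ℝ} (h0 : ∀ q, 0 ≤ ψ q)
    (h1 : ∀ q, ψ q ≤ 1 / 2) (hdiv : ¬ Summable ψ) {κ : ℝ} (hκ : 0 < κ)
    (hφ : ∀ q, ψ q ≠ 0 → κ * q ≤ Nat.totient q) :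
    ∀ᵐ α ∂(volume.restrict (Set.Ioc (0 : ℝ) 1)), ∃ᶠ q : ℕ in atTop, nint (q * α) < ψ q := by
  have hmp := (AddCircle.measurePreserving_mk 1 0).quasiMeasurePreserving
  rw [zero_add] at hmp
  have hδ : Tendsto (fun q : ℕ => ψ q / q) atTop (nhds 0) := by
    refine squeeze_zero (fun q => div_nonneg (h0 q) (Nat.cast_nonneg q))
      (fun q => div_le_div_of_nonneg_right (h1 q) (Nat.cast_nonneg q)) ?_
    exact tendsto_const_div_atTop_nhds_zero_nat _
  rcases AddCircle.addWellApproximable_ae_empty_or_univ (T := (1 : ℝ)) _ hδ with h | h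
  · exfalso
    have h := hmp.ae h
    rw [ae_restrict_iff' measurableSet_Ioc, ae_iff] at h
    refine (volume_frequently_nearReduced_pos h0 h1 hdiv hκ hφ).ne' (measure_mono_null ?_ h)
    intro x hx
    have hx1 := Set.mem_iInter.1 hx 0
    simp only [Set.mem_iUnion, exists_prop] at hx1
    obtain ⟨q, hq, hxq⟩ := hx1
    have hx01 := nearReduced_subset_Ioo h1 (by omega) hxq
    rw [Set.mem_ofPred_eq, Classical.not_imp, not_not]
    refine ⟨⟨hx01.1, hx01.2.le⟩, ?_⟩
    rw [UnitAddCircle.mem_addWellApproximable_iff]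
    refine Set.infinite_of_forall_exists_gt fun n => ?_
    have hxn := Set.mem_iInter.1 hx n
    simp only [Set.mem_iUnion, exists_prop, nearReduced] at hxn
    obtain ⟨q, hq, a, ha, hxa⟩ := hxn
    obtain ⟨-, ha2, ha3⟩ := mem_reducedResidues (by omega) ha
    refine ⟨q, ⟨a, by omega, ha3.symm, ?_⟩, by omega⟩
    rw [← AddCircle.coe_sub, UnitAddCircle.norm_eq]
    rw [Metric.mem_ball, Real.dist_eq] at hxa
    refine lt_of_le_of_lt ?_ hxa
    simpa using round_le (x - a / q : ℝ) 0
  · have h := hmp.ae h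
    filter_upwards [h] with x hx
    rw [UnitAddCircle.mem_addWellApproximable_iff] at hx
    rw [frequently_atTop]
    intro n
    obtain ⟨q, ⟨m, hm, -, hlt⟩, hq⟩ := hx.exists_gt n
    refine ⟨q, hq.le, ?_⟩
    have hqR : (0 : ℝ) < q := by
      have : 0 < q := by omega
      exact_mod_cast this
    rw [← AddCircle.coe_sub, UnitAddCircle.norm_eq, lt_div_iff₀ hqR] at hlt
    refine lt_of_le_of_lt (round_le _ ((m : ℤ) + q * round (x - (m : ℝ) / q))) ?_
    refine lt_of_eq_of_lt ?_ hlt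
    rw [← abs_of_pos hqR, ← abs_mul, abs_of_pos hqR]
    congr 1
    push_cast
    field_simp
    ring

theorem sum_range_mul_of_periodic {m M : ℕ} (hm : 0 < m) (hM : 0 < M) (hmM : m.Coprime M)
    {f c : ℕ → ℝ} (hf : Function.Periodic f m) (hc : Function.Periodic c M) :
    ∑ n ∈ Finset.range (m * M), f n * c n =
      (∑ n ∈ Finset.range m, f n) * ∑ n ∈ Finset.range M, c n := by
  rw [Finset.sum_mul_sum, ← Finset.sum_product']
  refine Finset.sum_nbij (fun n => (n % m, n % M)) ?_ ?_ ?_ ?_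
  · intro n _
    simp [Nat.mod_lt, hm, hM]
  · intro x hx y hy hxy
    simp only [Prod.mk.injEq] at hxy
    have h := (Nat.modEq_and_modEq_iff_modEq_mul hmM).1 hxy
    simp only [Finset.coe_range, Set.mem_Iio] at hx hy
    exact h.eq_of_lt_of_lt hx hy
  · rintro ⟨a, b⟩ hab
    simp only [Finset.coe_product, Finset.coe_range, Set.mem_prod, Set.mem_Iio] at hab
    obtain ⟨k, hk⟩ := Nat.chineseRemainder hmM a b
    refine ⟨k % (m * M), by simpa using Nat.mod_lt _ (Nat.mul_pos hm hM), ?_⟩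
    simp only [Prod.mk.injEq]
    rw [Nat.mod_mul_right_mod, Nat.mod_mul_left_mod]
    exact ⟨Eq.trans hk.1 (Nat.mod_eq_of_lt hab.1), Eq.trans hk.2 (Nat.mod_eq_of_lt hab.2)⟩
  · intro n _
    simp [hf.map_mod_nat, hc.map_mod_nat]

theorem sum_range_mul_add_of_periodic {T : ℕ} {h : ℕ → ℝ} (hh : Function.Periodic h T) (q r : ℕ) :
    ∑ n ∈ Finset.range (q * T + r), h n =
      q * ∑ n ∈ Finset.range T, h n + ∑ n ∈ Finset.range r, h n := by
  have hq : ∀ q : ℕ, ∀ n, h (q * T + n) = h n := fun q n => by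
    rw [add_comm]; exact hh.nat_mul q n
  rw [Finset.sum_range_add, Finset.sum_congr rfl fun n _ => hq q n]
  congr 1
  induction q with
  | zero => simp
  | succ q ih =>
    rw [Nat.succ_mul, Finset.sum_range_add, ih, Finset.sum_congr rfl fun n _ => hq q n]
    push_cast; ring

theorem sum_range_le_of_periodic {T : ℕ} (hT : 0 < T) {h : ℕ → ℝ} (hh : Function.Periodic h T)
    {C E : ℝ} (hE : 0 ≤ E) (hC : ∀ n, h n ≤ C) (hC0 : 0 ≤ C)
    (hsum : ∑ n ∈ Finset.range T, h n = T * E) (X : ℕ) :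
    ∑ n ∈ Finset.range X, h n ≤ X * E + T * C := by
  have hX := Nat.div_add_mod' X T
  rw [← hX, sum_range_mul_add_of_periodic hh, hsum]
  have h1 : ∑ n ∈ Finset.range (X % T), h n ≤ (X % T : ℕ) * C := by
    simpa using Finset.sum_le_card_nsmul (Finset.range (X % T)) h C fun n _ => hC n
  have h2 : ((X % T : ℕ) : ℝ) ≤ T := by exact_mod_cast (Nat.mod_lt _ hT).le
  have h3 : ((X % T : ℕ) : ℝ) * C ≤ T * C := by gcongr
  have h4 : 0 ≤ ((X % T : ℕ) : ℝ) * E := by positivity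
  push_cast
  linarith

section LocalFunctions

variable {b : ℕ → ℕ → ℝ} {g : ℕ → ℝ}

theorem periodic_prod_primeFactors (hper : ∀ p, p.Prime → Function.Periodic (b p) p) (k : ℕ) :
    Function.Periodic (fun n => ∏ p ∈ k.primeFactors, b p n) k := by
  intro n
  refine Finset.prod_congr rfl fun p hp => ?_
  obtain ⟨c, hc⟩ := Nat.dvd_of_mem_primeFactors hp
  have := (hper p (Nat.prime_of_mem_primeFactors hp)).nat_mul c n
  rwa [Nat.cast_id, mul_comm c p, ← hc] at this

theorem abs_prod_primeFactors_le (hb : ∀ p, p.Prime → ∀ n, |b p n| ≤ p) {k : ℕ} (hk : k ≠ 0)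
    (n : ℕ) : |∏ p ∈ k.primeFactors, b p n| ≤ k := by
  rw [Finset.abs_prod]
  calc _ ≤ ∏ p ∈ k.primeFactors, (p : ℝ) := Finset.prod_le_prod (fun _ _ => abs_nonneg _)
        fun p hp => hb p (Nat.prime_of_mem_primeFactors hp) n
    _ ≤ k := by
      rw [← Nat.cast_prod]
      exact_mod_cast Nat.le_of_dvd (Nat.pos_of_ne_zero hk) (Nat.prod_primeFactors_dvd k)

theorem sum_range_prod_mul_prod_eq_zero (hper : ∀ p, p.Prime → Function.Periodic (b p) p)
    (hmean : ∀ p, p.Prime → ∑ n ∈ Finset.range p, b p n = 0) {k l p : ℕ} (hk : Squarefree k)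
    (hl : l ≠ 0) (hp : p.Prime) (hpk : p ∣ k) (hpl : ¬ p ∣ l) :
    ∑ n ∈ Finset.range (k * l),
      (∏ p ∈ k.primeFactors, b p n) * ∏ p ∈ l.primeFactors, b p n = 0 := by
  obtain ⟨m, rfl⟩ := hpk
  have hm0 : m ≠ 0 := by rintro rfl; simp at hk
  have hpm : p.Coprime m := Nat.coprime_of_squarefree_mul hk
  have hpl' : p.Coprime l := (Nat.Prime.coprime_iff_not_dvd hp).2 hpl
  have e : ∀ n, (∏ q ∈ (p * m).primeFactors, b q n) * ∏ q ∈ l.primeFactors, b q n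
      = b p n * ((∏ q ∈ m.primeFactors, b q n) * ∏ q ∈ l.primeFactors, b q n) := by
    intro n
    rw [hpm.primeFactors_mul, Finset.prod_union hpm.disjoint_primeFactors, hp.primeFactors,
      Finset.prod_singleton, mul_assoc]
  rw [Finset.sum_congr rfl fun n _ => e n, mul_assoc, sum_range_mul_of_periodic hp.pos
    (by positivity) (hpm.mul_right hpl') (hper p hp), hmean p hp, zero_mul]
  have h1 := periodic_prod_primeFactors hper m
  have h2 := periodic_prod_primeFactors hper l
  refine Function.Periodic.mul ?_ ?_
  · rw [mul_comm]; exact h1.nat_mul l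
  · exact h2.nat_mul m

theorem sum_range_prod_sq (hper : ∀ p, p.Prime → Function.Periodic (b p) p)
    (hvar : ∀ p, p.Prime → ∑ n ∈ Finset.range p, b p n ^ 2 = p * g p) {k : ℕ}
    (hk : Squarefree k) :
    ∑ n ∈ Finset.range k, (∏ p ∈ k.primeFactors, b p n) ^ 2 =
      k * ∏ p ∈ k.primeFactors, g p := by
  induction k using Nat.recOnMul with
  | zero => simp at hk
  | one => simp
  | prime p hp => simp [hp.primeFactors, hvar p hp]
  | mul m n ihm ihn =>
    have hc := Nat.coprime_of_squarefree_mul hk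
    have hm := hk.of_mul_left
    have hn := hk.of_mul_right
    have e : ∀ j, (∏ q ∈ (m * n).primeFactors, b q j) ^ 2
        = (∏ q ∈ m.primeFactors, b q j) ^ 2 * (∏ q ∈ n.primeFactors, b q j) ^ 2 := by
      intro j
      rw [hc.primeFactors_mul, Finset.prod_union hc.disjoint_primeFactors, mul_pow]
    rw [Finset.sum_congr rfl fun j _ => e j, sum_range_mul_of_periodic
      (Nat.pos_of_ne_zero hm.ne_zero) (Nat.pos_of_ne_zero hn.ne_zero) hc, ihm hm, ihn hn,
      hc.primeFactors_mul, Finset.prod_union hc.disjoint_primeFactors]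
    · push_cast; ring
    · exact (periodic_prod_primeFactors hper m).comp (· ^ 2)
    · exact (periodic_prod_primeFactors hper n).comp (· ^ 2)

/-- An upper bound sieve: `A` is bounded by testing against the almost orthogonal functions
`n ↦ ∏ p ∣ k, b p n`. -/
theorem card_mul_sq_le_of_local (hper : ∀ p, p.Prime → Function.Periodic (b p) p)
    (hmean : ∀ p, p.Prime → ∑ n ∈ Finset.range p, b p n = 0)
    (hvar : ∀ p, p.Prime → ∑ n ∈ Finset.range p, b p n ^ 2 = p * g p)
    (hb : ∀ p, p.Prime → ∀ n, |b p n| ≤ p) (hg : ∀ p, p.Prime → 0 ≤ g p)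
    {R X : ℕ} {A : Finset ℕ} (hA : A ⊆ Finset.range X)
    (hAb : ∀ n ∈ A, ∀ p, p.Prime → p ≤ R → b p n = g p) :
    (A.card : ℝ) * (∑ k ∈ (Finset.Icc 1 R).filter Squarefree, ∏ p ∈ k.primeFactors, g p) ^ 2 ≤
      X * (∑ k ∈ (Finset.Icc 1 R).filter Squarefree, ∏ p ∈ k.primeFactors, g p) + R ^ 6 := by
  set K := (Finset.Icc 1 R).filter Squarefree with hK
  set G := ∑ k ∈ K, ∏ p ∈ k.primeFactors, g p with hG
  have hg' : ∀ k : ℕ, 0 ≤ ∏ p ∈ k.primeFactors, g p := fun k =>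
    Finset.prod_nonneg fun p hp => hg p (Nat.prime_of_mem_primeFactors hp)
  have hmem : ∀ k ∈ K, 1 ≤ k ∧ k ≤ R ∧ Squarefree k := fun k hk => by
    simpa [hK, and_assoc] using hk
  have hF : ∀ n ∈ A, ∑ k ∈ K, ∏ p ∈ k.primeFactors, b p n = G := fun n hn =>
    Finset.sum_congr rfl fun k hk => Finset.prod_congr rfl fun p hp =>
      hAb n hn p (Nat.prime_of_mem_primeFactors hp)
        ((Nat.le_of_mem_primeFactors hp).trans (hmem k hk).2.1)
  have hpair : ∀ k ∈ K, ∀ l ∈ K, ∑ n ∈ Finset.range X,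
      (∏ p ∈ k.primeFactors, b p n) * ∏ p ∈ l.primeFactors, b p n ≤
        X * (if k = l then ∏ p ∈ k.primeFactors, g p else 0) + (R : ℝ) ^ 4 := by
    intro k hk l hl
    obtain ⟨hk1, hkR, hksq⟩ := hmem k hk
    obtain ⟨hl1, hlR, hlsq⟩ := hmem l hl
    have hperk := periodic_prod_primeFactors hper k
    have hperl := periodic_prod_primeFactors hper l
    have hper' : Function.Periodic (fun n => (∏ p ∈ k.primeFactors, b p n) *
        ∏ p ∈ l.primeFactors, b p n) (k * l) := by
      refine Function.Periodic.mul ?_ ?_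
      · rw [mul_comm]; exact hperk.nat_mul l
      · exact hperl.nat_mul k
    have hsum : ∑ n ∈ Finset.range (k * l),
        (∏ p ∈ k.primeFactors, b p n) * ∏ p ∈ l.primeFactors, b p n =
        ((k * l : ℕ) : ℝ) * (if k = l then ∏ p ∈ k.primeFactors, g p else 0) := by
      split_ifs with hkl
      · subst hkl
        have := sum_range_mul_add_of_periodic (hperk.comp (· ^ 2)) k 0
        simp only [add_zero, Finset.range_zero, Finset.sum_empty, Function.comp_apply] at this
        rw [sum_range_prod_sq hper hvar hksq] at this
        simp only [← sq (∏ p ∈ k.primeFactors, b p _)]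
        rw [this]; push_cast; ring
      · rw [mul_zero]
        by_cases h : ∃ p, p.Prime ∧ p ∣ k ∧ ¬ p ∣ l
        · obtain ⟨p, hp, hpk, hpl⟩ := h
          exact sum_range_prod_mul_prod_eq_zero hper hmean hksq (by omega) hp hpk hpl
        · have : ∃ p, p.Prime ∧ p ∣ l ∧ ¬ p ∣ k := by
            by_contra h'
            push Not at h h'
            exact hkl ((Nat.Squarefree.ext_iff hksq hlsq).2 fun p hp => ⟨h p hp, h' p hp⟩)
          obtain ⟨p, hp, hpl, hpk⟩ := this
          have := sum_range_prod_mul_prod_eq_zero hper hmean hlsq (by omega) hp hpl hpk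
          rw [mul_comm l k] at this
          rw [← this]
          exact Finset.sum_congr rfl fun n _ => mul_comm _ _
    have hkR' : (k : ℝ) ≤ R := by exact_mod_cast hkR
    have hlR' : (l : ℝ) ≤ R := by exact_mod_cast hlR
    refine (sum_range_le_of_periodic (Nat.mul_pos hk1 hl1) hper' (C := k * l) ?_ ?_
      (by positivity) hsum X).trans ?_
    · split_ifs
      exacts [hg' k, le_rfl]
    · intro n
      refine (le_abs_self _).trans ?_
      rw [abs_mul]
      exact mul_le_mul (abs_prod_primeFactors_le hb (by omega) n)
        (abs_prod_primeFactors_le hb (by omega) n) (abs_nonneg _) (by positivity)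
    · refine add_le_add le_rfl ?_
      push_cast
      calc (k : ℝ) * l * (k * l) ≤ (R : ℝ) * R * (R * R) := by gcongr
        _ = _ := by ring
  have hKcard : (K.card : ℝ) ≤ R := by
    have : K.card ≤ (Finset.Icc 1 R).card := Finset.card_filter_le _ _
    rw [Nat.card_Icc] at this
    exact_mod_cast this
  calc (A.card : ℝ) * G ^ 2 = ∑ n ∈ A, (∑ k ∈ K, ∏ p ∈ k.primeFactors, b p n) ^ 2 := by
        rw [Finset.sum_congr rfl fun n hn => by rw [hF n hn], Finset.sum_const, nsmul_eq_mul]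
    _ ≤ ∑ n ∈ Finset.range X, (∑ k ∈ K, ∏ p ∈ k.primeFactors, b p n) ^ 2 :=
        Finset.sum_le_sum_of_subset_of_nonneg hA fun _ _ _ => sq_nonneg _
    _ = ∑ k ∈ K, ∑ l ∈ K, ∑ n ∈ Finset.range X,
          (∏ p ∈ k.primeFactors, b p n) * ∏ p ∈ l.primeFactors, b p n := by
        simp_rw [sq, Finset.sum_mul_sum]
        rw [Finset.sum_comm]
        exact Finset.sum_congr rfl fun k _ => Finset.sum_comm
    _ ≤ ∑ k ∈ K, ∑ l ∈ K,
          (X * (if k = l then ∏ p ∈ k.primeFactors, g p else 0) + (R : ℝ) ^ 4) :=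
        Finset.sum_le_sum fun k hk => Finset.sum_le_sum fun l hl => hpair k hk l hl
    _ = X * G + K.card * K.card * (R : ℝ) ^ 4 := by
        simp only [Finset.sum_add_distrib, ← Finset.mul_sum, Finset.sum_const, nsmul_eq_mul]
        congr 1
        · congr 1
          exact Finset.sum_congr rfl fun k hk => by rw [Finset.sum_ite_eq, if_pos hk]
        · ring
    _ ≤ X * G + R * R * (R : ℝ) ^ 4 := by gcongr
    _ = _ := by ring

end LocalFunctions

theorem sum_le_prod_inv_of_subset_factoredNumbers {f : ℕ →* ℝ} (h0 : ∀ n, 0 ≤ f n)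
    (h1 : ∀ p, p.Prime → f p < 1) {s T : Finset ℕ} (hs : ∀ p ∈ s, p.Prime)
    (hT : ∀ n ∈ T, n ∈ Nat.factoredNumbers s) :
    ∑ n ∈ T, f n ≤ ∏ p ∈ s, (1 - f p)⁻¹ := by
  have hE := (EulerProduct.summable_and_hasSum_factoredNumbers_prod_filter_prime_geometric
    (f := f) (fun {p} hp => by rw [Real.norm_of_nonneg (h0 p)]; exact h1 p hp) s).2
  rw [Finset.filter_true_of_mem hs] at hE
  have := sum_le_hasSum (f := fun m : Nat.factoredNumbers s => f m)
    (T.attach.image fun n => ⟨n.1, hT n.1 n.2⟩) (fun i _ => h0 i) hE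
  rw [Finset.sum_image fun x _ y _ h => Subtype.ext (by simpa using h)] at this
  rwa [← Finset.sum_attach]

theorem sum_Icc_le_sum_squarefree {f : ℕ →* ℝ} (h0 : ∀ n, 0 ≤ f n)
    (h1 : ∀ p, p.Prime → f p < 1) (R : ℕ) :
    ∑ m ∈ Finset.Icc 1 R, f m ≤
      ∑ k ∈ (Finset.Icc 1 R).filter Squarefree, ∏ p ∈ k.primeFactors, f p / (1 - f p) := by
  have hmaps : ∀ m ∈ Finset.Icc 1 R,
      ∏ p ∈ m.primeFactors, p ∈ (Finset.Icc 1 R).filter Squarefree := by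
    intro m hm
    rw [Finset.mem_Icc] at hm
    have hle := Nat.le_of_dvd (by omega) (Nat.prod_primeFactors_dvd m)
    have hsq : Squarefree (∏ p ∈ m.primeFactors, p) := by
      refine Finset.squarefree_prod_of_pairwise_isCoprime (fun p hp q hq hpq => ?_)
        fun p hp => (Nat.prime_of_mem_primeFactors hp).squarefree
      exact Nat.coprime_iff_isRelPrime.1 ((Nat.coprime_primes (Nat.prime_of_mem_primeFactors hp)
        (Nat.prime_of_mem_primeFactors hq)).2 hpq)
    simp only [Finset.mem_filter, Finset.mem_Icc]
    exact ⟨⟨Nat.pos_of_ne_zero hsq.ne_zero, hle.trans hm.2⟩, hsq⟩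
  rw [← Finset.sum_fiberwise_of_maps_to hmaps]
  refine Finset.sum_le_sum fun k hk => ?_
  rw [Finset.mem_filter] at hk
  have hk0 : 0 < k := Nat.pos_of_ne_zero hk.2.ne_zero
  have hfk : f k = ∏ p ∈ k.primeFactors, f p := by
    conv_lhs => rw [← Nat.prod_primeFactors_of_squarefree hk.2]
    rw [map_prod]
  rw [Finset.prod_congr rfl fun p _ => div_eq_mul_inv _ _, Finset.prod_mul_distrib, ← hfk]
  set S := (Finset.Icc 1 R).filter fun m => ∏ p ∈ m.primeFactors, p = k with hS
  have hdvd : ∀ m ∈ S, k * (m / k) = m := by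
    intro m hm
    rw [hS, Finset.mem_filter] at hm
    exact Nat.mul_div_cancel' (hm.2 ▸ Nat.prod_primeFactors_dvd m)
  have hmem : ∀ m ∈ S, m / k ∈ Nat.factoredNumbers k.primeFactors := by
    intro m hm
    have hm' := hm
    rw [hS, Finset.mem_filter, Finset.mem_Icc] at hm'
    rw [Nat.mem_factoredNumbers']
    intro p hp hpm
    rw [Nat.mem_primeFactors]
    refine ⟨hp, ?_, hk0.ne'⟩
    rw [← hm'.2]
    refine Finset.dvd_prod_of_mem _ (Nat.mem_primeFactors.2 ⟨hp, ?_, by omega⟩)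
    rw [← hdvd m hm]
    exact hpm.mul_left k
  have e : ∑ m ∈ S, f m = f k * ∑ m ∈ S, f (m / k) := by
    rw [Finset.mul_sum]
    refine Finset.sum_congr rfl fun m hm => ?_
    rw [← map_mul, hdvd m hm]
  rw [e]
  refine mul_le_mul_of_nonneg_left ?_ (h0 k)
  rw [← Finset.sum_image (s := S) (g := fun m => m / k) (f := f) fun m hm n hn h => by
    rw [← hdvd m hm, ← hdvd n hn]; exact congrArg _ h]
  refine sum_le_prod_inv_of_subset_factoredNumbers h0 h1
    (fun p hp => Nat.prime_of_mem_primeFactors hp) fun n hn => ?_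
  obtain ⟨m, hm, rfl⟩ := Finset.mem_image.1 hn
  exact hmem m hm

theorem exists_eq_mul_factoredNumbers_coprime (d : ℕ) (b : ℕ) (hb : b ≠ 0) :
    ∃ e c, b = e * c ∧ (d ≠ 0 → e ∈ Nat.factoredNumbers d.primeFactors) ∧ c.Coprime d := by
  induction b using Nat.recOnMul with
  | zero => simp at hb
  | one => exact ⟨1, 1, rfl, fun _ => by simp [Nat.mem_factoredNumbers], by simp⟩
  | prime p hp =>
    by_cases h : p ∣ d
    · refine ⟨p, 1, by simp, fun hd => ?_, by simp⟩
      rw [Nat.mem_factoredNumbers']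
      intro q hq hqp
      rw [(Nat.prime_dvd_prime_iff_eq hq hp).1 hqp]
      exact Nat.mem_primeFactors.2 ⟨hp, h, hd⟩
    · exact ⟨1, p, by simp, fun _ => by simp [Nat.mem_factoredNumbers],
        (Nat.Prime.coprime_iff_not_dvd hp).2 h⟩
  | mul m n ihm ihn =>
    obtain ⟨e, c, h, he, hc⟩ := ihm (by rintro rfl; simp at hb)
    obtain ⟨e', c', h', he', hc'⟩ := ihn (by rintro rfl; simp at hb)
    exact ⟨e * e', c * c', by rw [h, h']; ring,
      fun hd => Nat.mul_mem_factoredNumbers (he hd) (he' hd), hc.mul_left hc'⟩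

theorem prod_primeFactors_inv_one_sub_inv {d : ℕ} (hd : 0 < d) :
    ∏ p ∈ d.primeFactors, (1 - (p : ℝ)⁻¹)⁻¹ = d / Nat.totient d := by
  have h : (Nat.totient d : ℝ) = d * ∏ p ∈ d.primeFactors, (1 - (p : ℝ)⁻¹) := by
    have := congrArg (Rat.cast : ℚ → ℝ) (Nat.totient_eq_mul_prod_factors d)
    push_cast at this
    exact this
  have hd' : (0 : ℝ) < d := by exact_mod_cast hd
  rw [h, Finset.prod_inv_distrib, div_mul_eq_div_div, div_self hd'.ne', one_div]

/-- The completely multiplicative function `n ↦ 1 / n`. -/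
noncomputable def natInvHom : ℕ →* ℝ where
  toFun n := (n : ℝ)⁻¹
  map_one' := by simp
  map_mul' m n := by push_cast; rw [mul_inv]

theorem natInvHom_lt_one {p : ℕ} (hp : p.Prime) : natInvHom p < 1 := by
  have : (1 : ℝ) < p := by exact_mod_cast hp.one_lt
  exact inv_lt_one_of_one_lt₀ this

theorem sum_inv_le_mul_sum_coprime_inv {d : ℕ} (hd : 0 < d) (y : ℕ) :
    ∑ b ∈ Finset.Icc 1 y, (b : ℝ)⁻¹ ≤
      d / Nat.totient d * ∑ c ∈ (Finset.Icc 1 y).filter (Nat.Coprime d), (c : ℝ)⁻¹ := by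
  choose! e c h he hc using exists_eq_mul_factoredNumbers_coprime d
  set B := Finset.Icc 1 y with hB
  have hB0 : ∀ b ∈ B, b ≠ 0 := fun b hb => by rw [hB, Finset.mem_Icc] at hb; omega
  calc ∑ b ∈ B, (b : ℝ)⁻¹ = ∑ b ∈ B, (fun x : ℕ × ℕ => (x.1 : ℝ)⁻¹ * (x.2 : ℝ)⁻¹) (e b, c b) := by
        refine Finset.sum_congr rfl fun b hb => ?_
        have := h b (hB0 b hb)
        conv_lhs => rw [this]
        push_cast; rw [mul_inv]
    _ = ∑ x ∈ B.image fun b => (e b, c b), (x.1 : ℝ)⁻¹ * (x.2 : ℝ)⁻¹ := by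
        rw [Finset.sum_image]
        intro m hm n hn hmn
        simp only [Prod.mk.injEq] at hmn
        rw [h m (hB0 m hm), h n (hB0 n hn), hmn.1, hmn.2]
    _ ≤ ∑ x ∈ (B.image e) ×ˢ B.filter (Nat.Coprime d), (x.1 : ℝ)⁻¹ * (x.2 : ℝ)⁻¹ := by
        refine Finset.sum_le_sum_of_subset_of_nonneg ?_ fun _ _ _ => by positivity
        intro x hx
        obtain ⟨b, hb, rfl⟩ := Finset.mem_image.1 hx
        have hb0 := hB0 b hb
        have hbm := hb
        rw [hB, Finset.mem_Icc] at hbm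
        simp only [Finset.mem_product, Finset.mem_filter]
        refine ⟨Finset.mem_image_of_mem _ hb, ?_, (hc b hb0).symm⟩
        have hcd : c b ∣ b := ⟨e b, by rw [mul_comm]; exact h b hb0⟩
        exact Finset.mem_Icc.2 ⟨Nat.pos_of_dvd_of_pos hcd (by omega),
          (Nat.le_of_dvd (by omega) hcd).trans hbm.2⟩
    _ = (∑ a ∈ B.image e, (a : ℝ)⁻¹) * ∑ c ∈ B.filter (Nat.Coprime d), (c : ℝ)⁻¹ := by
        rw [Finset.sum_product, Finset.sum_mul_sum]
    _ ≤ _ := by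
        gcongr
        rw [← prod_primeFactors_inv_one_sub_inv hd]
        refine sum_le_prod_inv_of_subset_factoredNumbers (f := natInvHom)
          (fun n => by simp [natInvHom]) (fun p hp => natInvHom_lt_one hp)
          (fun p hp => Nat.prime_of_mem_primeFactors hp) fun n hn => ?_
        obtain ⟨b, hb, rfl⟩ := Finset.mem_image.1 hn
        exact he b (hB0 b hb) hd.ne'

/-- The number of solutions of `n (n + d) = 0` modulo a prime `p`. -/
def numRoots (d p : ℕ) : ℕ := if p ∣ d then 1 else 2

/-- The completely multiplicative function with value `numRoots d p / p` at a prime `p`. -/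
noncomputable def sieveHom (d : ℕ) : ℕ →* ℝ where
  toFun n := ((n.primeFactorsList.map (numRoots d)).prod : ℝ) / n
  map_one' := by simp
  map_mul' m n := by
    rcases eq_or_ne m 0 with rfl | hm
    · simp
    rcases eq_or_ne n 0 with rfl | hn
    · simp
    rw [((Nat.perm_primeFactorsList_mul hm hn).map _).prod_eq, List.map_append, List.prod_append]
    push_cast
    rw [mul_div_mul_comm]

theorem sieveHom_apply (d n : ℕ) :
    sieveHom d n = ((n.primeFactorsList.map (numRoots d)).prod : ℝ) / n := rfl

theorem sieveHom_nonneg (d n : ℕ) : 0 ≤ sieveHom d n := by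
  rw [sieveHom_apply]; positivity

theorem sieveHom_prime (d : ℕ) {p : ℕ} (hp : p.Prime) : sieveHom d p = numRoots d p / p := by
  simp [sieveHom_apply, Nat.primeFactorsList_prime hp]

theorem card_divisors_coprime_le (d m : ℕ) (hm : m ≠ 0) :
    (m.divisors.filter (Nat.Coprime d)).card ≤ m * sieveHom d m := by
  induction m using Nat.recOnMul with
  | zero => simp at hm
  | one => simpa using Finset.card_filter_le {1} d.Coprime
  | prime p hp =>
    rw [sieveHom_prime d hp, mul_div_cancel₀ _ (by exact_mod_cast hp.ne_zero)]
    norm_cast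
    rw [hp.divisors, numRoots]
    split_ifs with h
    · rw [Finset.card_le_one]
      have : ¬ d.Coprime p := fun h' => (Nat.Prime.coprime_iff_not_dvd hp).1 h'.symm h
      intro a ha b hb
      simp only [Finset.mem_filter, Finset.mem_insert, Finset.mem_singleton] at ha hb
      rcases ha with ⟨rfl | rfl, ha⟩ <;> rcases hb with ⟨rfl | rfl, hb⟩ <;> tauto
    · exact (Finset.card_filter_le _ _).trans Finset.card_le_two
  | mul m n ihm ihn =>
    have hm0 : m ≠ 0 := by rintro rfl; simp at hm
    have hn0 : n ≠ 0 := by rintro rfl; simp at hm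
    have hsub : (m * n).divisors.filter (Nat.Coprime d) ⊆
        ((m.divisors.filter (Nat.Coprime d)) ×ˢ (n.divisors.filter (Nat.Coprime d))).image
          fun x => x.1 * x.2 := by
      intro k hk
      rw [Finset.mem_filter, Nat.mem_divisors] at hk
      obtain ⟨a, b, ha, hb, rfl⟩ := (Nat.dvd_mul).1 hk.1.1
      refine Finset.mem_image.2 ⟨(a, b), ?_, rfl⟩
      simp only [Finset.mem_product, Finset.mem_filter, Nat.mem_divisors]
      exact ⟨⟨⟨ha, hm0⟩, hk.2.coprime_mul_right_right⟩, ⟨hb, hn0⟩, hk.2.coprime_mul_left_right⟩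
    have := (Finset.card_le_card hsub).trans Finset.card_image_le
    rw [Finset.card_product] at this
    calc ((((m * n).divisors.filter (Nat.Coprime d)).card : ℕ) : ℝ)
        ≤ ((m.divisors.filter (Nat.Coprime d)).card : ℝ) *
            (n.divisors.filter (Nat.Coprime d)).card := by exact_mod_cast this
      _ ≤ (m * sieveHom d m) * (n * sieveHom d n) :=
        mul_le_mul (ihm hm0) (ihn hn0) (by positivity)
          (mul_nonneg (by positivity) (sieveHom_nonneg _ _))
      _ = _ := by rw [map_mul]; push_cast; ring

theorem sum_inv_mul_sum_coprime_inv_le (d y : ℕ) :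
    (∑ a ∈ Finset.Icc 1 y, (a : ℝ)⁻¹) * (∑ c ∈ (Finset.Icc 1 y).filter (Nat.Coprime d), (c : ℝ)⁻¹)
      ≤ ∑ m ∈ Finset.Icc 1 (y ^ 2), sieveHom d m := by
  rw [Finset.sum_mul_sum, ← Finset.sum_product']
  have hmaps : ∀ x ∈ Finset.Icc 1 y ×ˢ (Finset.Icc 1 y).filter (Nat.Coprime d),
      x.1 * x.2 ∈ Finset.Icc 1 (y ^ 2) := by
    intro x hx
    simp only [Finset.mem_product, Finset.mem_filter, Finset.mem_Icc] at hx ⊢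
    exact ⟨Nat.mul_pos hx.1.1 hx.2.1.1, by rw [pow_two]; exact Nat.mul_le_mul hx.1.2 hx.2.1.2⟩
  rw [← Finset.sum_fiberwise_of_maps_to hmaps]
  refine Finset.sum_le_sum fun m hm => ?_
  have hm0 : m ≠ 0 := by rw [Finset.mem_Icc] at hm; omega
  have hmR : (0 : ℝ) < m := by exact_mod_cast Nat.pos_of_ne_zero hm0
  calc _ = ∑ x ∈ (Finset.Icc 1 y ×ˢ (Finset.Icc 1 y).filter (Nat.Coprime d)).filter
          (fun x => x.1 * x.2 = m), (m : ℝ)⁻¹ := by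
        refine Finset.sum_congr rfl fun x hx => ?_
        rw [← (Finset.mem_filter.1 hx).2, ← mul_inv]; push_cast; rfl
    _ = (((Finset.Icc 1 y ×ˢ (Finset.Icc 1 y).filter (Nat.Coprime d)).filter
          (fun x => x.1 * x.2 = m)).card : ℝ) * (m : ℝ)⁻¹ := by
        rw [Finset.sum_const, nsmul_eq_mul]
    _ ≤ ((m.divisors.filter (Nat.Coprime d)).card : ℝ) * (m : ℝ)⁻¹ := by
        gcongr
        refine Finset.card_le_card_of_injOn (fun x => x.2) ?_ ?_
        · intro x hx
          simp only [Finset.coe_filter, Finset.mem_product, Finset.mem_filter, Finset.mem_Icc,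
            Set.mem_ofPred_eq, Nat.mem_divisors] at hx ⊢
          exact ⟨⟨⟨x.1, by rw [mul_comm, hx.2]⟩, hm0⟩, hx.1.2.2⟩
        · intro x hx z hz hxz
          simp only [Finset.coe_filter, Finset.mem_product, Finset.mem_filter, Finset.mem_Icc,
            Set.mem_ofPred_eq] at hx hz hxz
          refine Prod.ext ?_ hxz
          refine Nat.eq_of_mul_eq_mul_right (Nat.lt_of_lt_of_le one_pos hx.1.2.1.1) ?_
          rw [hx.2, ← hz.2, hxz]
    _ ≤ m * sieveHom d m * (m : ℝ)⁻¹ := by gcongr; exact card_divisors_coprime_le d m hm0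
    _ = sieveHom d m := by field_simp

theorem numRoots_lt {d p : ℕ} (hd : 2 ∣ d) (hp : p.Prime) : numRoots d p < p := by
  rw [numRoots]
  split_ifs with h
  · exact hp.one_lt
  · exact lt_of_le_of_ne hp.two_le fun h2 => h (h2 ▸ hd)

theorem log_sq_mul_totient_le {d : ℕ} (hd : 0 < d) (hd2 : 2 ∣ d) {y : ℕ} (hy : 1 ≤ y) :
    Real.log y ^ 2 * (Nat.totient d / d) ≤ ∑ k ∈ (Finset.Icc 1 (y ^ 2)).filter Squarefree,
      ∏ p ∈ k.primeFactors, (numRoots d p : ℝ) / (p - numRoots d p) := by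
  have hd' : (0 : ℝ) < d := by exact_mod_cast hd
  have hφ : (0 : ℝ) < Nat.totient d := by exact_mod_cast Nat.totient_pos.2 hd
  have h1 : ∀ p, p.Prime → sieveHom d p < 1 := fun p hp => by
    have : (0 : ℝ) < p := by exact_mod_cast hp.pos
    rw [sieveHom_prime d hp, div_lt_one this]
    exact_mod_cast numRoots_lt hd2 hp
  have hlog : Real.log y ≤ ∑ b ∈ Finset.Icc 1 y, (b : ℝ)⁻¹ := by
    have := log_le_harmonic_floor (y : ℝ) (by positivity)
    rw [Nat.floor_natCast, harmonic_eq_sum_Icc] at this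
    push_cast at this
    exact this
  have hlog0 : 0 ≤ Real.log y := Real.log_natCast_nonneg y
  have hS := sum_inv_le_mul_sum_coprime_inv hd y
  have hP := (sum_inv_mul_sum_coprime_inv_le d y).trans
    (sum_Icc_le_sum_squarefree (sieveHom_nonneg d) h1 (y ^ 2))
  set S := ∑ b ∈ Finset.Icc 1 y, (b : ℝ)⁻¹
  set S' := ∑ c ∈ (Finset.Icc 1 y).filter (Nat.Coprime d), (c : ℝ)⁻¹
  calc Real.log y ^ 2 * (Nat.totient d / d) ≤ (S * S) * (Nat.totient d / d) := by
        rw [pow_two]; gcongr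
    _ ≤ (S * (d / Nat.totient d * S')) * (Nat.totient d / d) := by
        gcongr
    _ = S * S' := by field_simp
    _ ≤ _ := hP
    _ = _ := by
        refine Finset.sum_congr rfl fun k _ => Finset.prod_congr rfl fun p hp => ?_
        have hp' := Nat.prime_of_mem_primeFactors hp
        have : (0 : ℝ) < p := by exact_mod_cast hp'.pos
        have h2 : (0 : ℝ) < p - numRoots d p := by
          have : (numRoots d p : ℝ) < p := by exact_mod_cast numRoots_lt hd2 hp'
          linarith
        have h3 : (0 : ℝ) < 1 - sieveHom d p := by linarith [h1 p hp']
        rw [div_eq_div_iff h3.ne' h2.ne', sieveHom_prime d hp']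
        field_simp

theorem card_range_filter_dvd_mul_add (d : ℕ) {p : ℕ} (hp : p.Prime) :
    ((Finset.range p).filter fun n => p ∣ n * (n + d)).card = numRoots d p := by
  have hp0 := hp.pos
  have hmod : d % p < p := Nat.mod_lt _ hp0
  rw [numRoots]
  split_ifs with h
  · have : (Finset.range p).filter (fun n => p ∣ n * (n + d)) = {0} := by
      ext n
      simp only [Finset.mem_filter, Finset.mem_range, Finset.mem_singleton]
      constructor
      · rintro ⟨hn, hdvd⟩
        refine Nat.eq_zero_of_dvd_of_lt ?_ hn
        rcases hp.dvd_mul.1 hdvd with h' | h'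
        · exact h'
        · exact (Nat.dvd_add_left h).1 h'
      · rintro rfl
        simpa using hp0
    rw [this, Finset.card_singleton]
  · have hne : d % p ≠ 0 := fun h' => h (Nat.dvd_of_mod_eq_zero h')
    have : (Finset.range p).filter (fun n => p ∣ n * (n + d)) = {0, p - d % p} := by
      ext n
      simp only [Finset.mem_filter, Finset.mem_range, Finset.mem_singleton, Finset.mem_insert]
      constructor
      · rintro ⟨hn, hdvd⟩
        rcases hp.dvd_mul.1 hdvd with h' | h'
        · exact Or.inl (Nat.eq_zero_of_dvd_of_lt h' hn)
        · right
          have h2 : p ∣ n + d % p := by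
            rw [← (Nat.dvd_add_left (Dvd.intro (d / p) rfl : p ∣ p * (d / p)))]
            rwa [add_assoc, Nat.mod_add_div]
          obtain ⟨k, hk⟩ := h2
          have : k = 1 := by
            rcases k with _ | _ | k
            · omega
            · rfl
            · nlinarith
          subst this
          omega
      · rintro (rfl | rfl)
        · simpa using hp0
        · refine ⟨by omega, Dvd.dvd.mul_left ?_ _⟩
          refine ⟨1 + d / p, ?_⟩
          have := Nat.mod_add_div d p
          rw [mul_add]
          omega
    rw [this, Finset.card_pair (by omega)]

theorem card_sieved_le {d : ℕ} (hd : 0 < d) (hd2 : 2 ∣ d) {X y : ℕ} (hy : 2 ≤ y) {A : Finset ℕ}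
    (hA : A ⊆ Finset.range X)
    (hAp : ∀ n ∈ A, ∀ p, p.Prime → p ≤ y ^ 2 → ¬ p ∣ n * (n + d)) :
    (A.card : ℝ) ≤ X * (d / Nat.totient d) / Real.log y ^ 2 + y ^ 12 := by
  set g : ℕ → ℝ := fun p => (numRoots d p : ℝ) / (p - numRoots d p) with hg
  have hden : ∀ p, p.Prime → (1 : ℝ) ≤ p - numRoots d p := fun p hp => by
    have : ((numRoots d p + 1 : ℕ) : ℝ) ≤ p := by exact_mod_cast numRoots_lt hd2 hp
    push_cast at this
    linarith
  have hg0 : ∀ p, p.Prime → 0 ≤ g p := fun p hp =>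
    div_nonneg (by positivity) (by linarith [hden p hp])
  have hg2 : ∀ p, p.Prime → g p ≤ p := fun p hp => by
    have h2 : (numRoots d p : ℝ) ≤ p := by exact_mod_cast (numRoots_lt hd2 hp).le
    exact (div_le_self (by positivity) (hden p hp)).trans h2
  have hsum : ∀ p, p.Prime → ∀ s t : ℝ,
      ∑ n ∈ Finset.range p, (if p ∣ n * (n + d) then s else t) =
        numRoots d p * s + (p - numRoots d p) * t := by
    intro p hp s t
    rw [Finset.sum_ite, Finset.sum_const, Finset.sum_const, card_range_filter_dvd_mul_add d hp]
    have := Finset.card_filter_add_card_filter_not (s := Finset.range p) (fun n => p ∣ n * (n + d))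
    rw [card_range_filter_dvd_mul_add d hp, Finset.card_range] at this
    have : (numRoots d p : ℝ) +
      ((Finset.range p).filter fun n => ¬ p ∣ n * (n + d)).card = p := by exact_mod_cast this
    rw [nsmul_eq_mul, nsmul_eq_mul, ← this, add_sub_cancel_left]
  have key := card_mul_sq_le_of_local (b := fun p n => if p ∣ n * (n + d) then (-1 : ℝ) else g p)
    (g := g) (R := y ^ 2) ?_ ?_ ?_ ?_ hg0 hA ?_
  · have hG := log_sq_mul_totient_le hd hd2 (y := y) (by omega)
    set G := ∑ k ∈ (Finset.Icc 1 (y ^ 2)).filter Squarefree, ∏ p ∈ k.primeFactors, g p with hGdef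
    have hG1 : 1 ≤ G := by
      have h1 : (1 : ℕ) ∈ (Finset.Icc 1 (y ^ 2)).filter Squarefree := by
        simp only [Finset.mem_filter, Finset.mem_Icc, squarefree_one, and_true, le_refl, true_and]
        exact Nat.one_le_pow _ _ (by omega)
      have := Finset.single_le_sum (f := fun k : ℕ => ∏ p ∈ k.primeFactors, g p)
        (fun k _ => Finset.prod_nonneg fun p hp => hg0 p (Nat.prime_of_mem_primeFactors hp)) h1
      simpa using this
    have hd' : (0 : ℝ) < d := by exact_mod_cast hd
    have hφ : (0 : ℝ) < Nat.totient d := by exact_mod_cast Nat.totient_pos.2 hd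
    have hlog : 0 < Real.log y := Real.log_pos (by exact_mod_cast hy)
    have h0 : 0 < Real.log y ^ 2 * (Nat.totient d / d) := by positivity
    calc (A.card : ℝ) ≤ X / G + y ^ 12 := by
          have hG0 : 0 < G := by linarith
          have : (A.card : ℝ) * G ^ 2 ≤ (X / G + y ^ 12) * G ^ 2 := by
            refine key.trans ?_
            have e : (X / G + (y : ℝ) ^ 12) * G ^ 2 = X * G + y ^ 12 * G ^ 2 := by
              field_simp
            rw [e]
            have : (1 : ℝ) ≤ G ^ 2 := one_le_pow₀ hG1
            have := le_mul_of_one_le_right (by positivity : (0 : ℝ) ≤ y ^ 12) this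
            push_cast
            rw [← pow_mul]
            norm_num
            exact this
          exact le_of_mul_le_mul_right this (by positivity)
      _ ≤ X / (Real.log y ^ 2 * (Nat.totient d / d)) + y ^ 12 := by gcongr
      _ = _ := by field_simp
  · intro p hp n
    simp only [Nat.dvd_iff_mod_eq_zero, Nat.mul_mod, Nat.add_mod, Nat.mod_self, add_zero,
      Nat.mod_mod]
  · intro p hp
    rw [hsum p hp]
    have := hden p hp
    have : (p : ℝ) - numRoots d p ≠ 0 := by linarith
    simp only [hg]
    field_simp
    ring
  · intro p hp
    simp only [ite_pow]
    rw [hsum p hp]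
    have := hden p hp
    have : (p : ℝ) - numRoots d p ≠ 0 := by linarith
    simp only [hg]
    field_simp
    ring
  · intro p hp n
    have : (1 : ℝ) ≤ p := by exact_mod_cast hp.one_le
    split_ifs
    · simpa using this
    · rw [abs_of_nonneg (hg0 p hp)]
      exact hg2 p hp
  · intro n hn p hp hpR
    simp [hAp n hn p hp hpR]

theorem sum_prod_primeFactors_one_add_le {h : ℕ → ℝ} (h0 : ∀ p, p.Prime → 0 ≤ h p) (x : ℕ) :
    ∑ d ∈ Finset.Icc 1 x, ∏ p ∈ d.primeFactors, (1 + h p) ≤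
      x * ∏ p ∈ (Finset.Icc 1 x).filter Nat.Prime, (1 + h p / p) := by
  set P := (Finset.Icc 1 x).filter Nat.Prime with hP
  have hsub : ∀ d ∈ Finset.Icc 1 x, d.primeFactors ⊆ P := by
    intro d hd p hp
    rw [Finset.mem_Icc] at hd
    have hp' := Nat.prime_of_mem_primeFactors hp
    exact Finset.mem_filter.2 ⟨Finset.mem_Icc.2 ⟨hp'.one_le,
      (Nat.le_of_mem_primeFactors hp).trans hd.2⟩, hp'⟩
  have hprod : ∀ s ∈ P.powerset, 0 ≤ ∏ p ∈ s, h p := fun s hs =>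
    Finset.prod_nonneg fun p hp => h0 p (Finset.mem_filter.1 (Finset.mem_powerset.1 hs hp)).2
  calc ∑ d ∈ Finset.Icc 1 x, ∏ p ∈ d.primeFactors, (1 + h p)
      = ∑ d ∈ Finset.Icc 1 x, ∑ s ∈ P.powerset, if s ⊆ d.primeFactors then ∏ p ∈ s, h p else 0 := by
        refine Finset.sum_congr rfl fun d hd => ?_
        rw [Finset.prod_one_add, ← Finset.sum_filter]
        refine Finset.sum_congr ?_ fun _ _ => rfl
        ext s
        simp only [Finset.mem_powerset, Finset.mem_filter]
        exact ⟨fun hs => ⟨hs.trans (hsub d hd), hs⟩, fun hs => hs.2⟩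
    _ = ∑ s ∈ P.powerset,
          (((Finset.Icc 1 x).filter fun d => s ⊆ d.primeFactors).card : ℝ) * ∏ p ∈ s, h p := by
        rw [Finset.sum_comm]
        refine Finset.sum_congr rfl fun s _ => ?_
        rw [← Finset.sum_filter, Finset.sum_const, nsmul_eq_mul]
    _ ≤ ∑ s ∈ P.powerset, (x / ∏ p ∈ s, (p : ℝ)) * ∏ p ∈ s, h p := by
        refine Finset.sum_le_sum fun s hs => mul_le_mul_of_nonneg_right ?_ (hprod s hs)
        have hle : ((Finset.Icc 1 x).filter fun d => s ⊆ d.primeFactors).card ≤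
            x / ∏ p ∈ s, p := by
          rw [← Nat.Ioc_filter_dvd_card_eq_div]
          refine Finset.card_le_card fun d hd => ?_
          simp only [Finset.mem_filter, Finset.mem_Icc, Finset.mem_Ioc] at hd ⊢
          refine ⟨⟨by omega, hd.1.2⟩, ?_⟩
          exact (Finset.prod_dvd_prod_of_subset _ _ _ hd.2).trans (Nat.prod_primeFactors_dvd d)
        calc _ ≤ ((x / ∏ p ∈ s, p : ℕ) : ℝ) := by exact_mod_cast hle
          _ ≤ _ := by
            refine Nat.cast_div_le.trans ?_
            push_cast
            exact le_rfl
    _ = x * ∑ s ∈ P.powerset, ∏ p ∈ s, h p / p := by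
        rw [Finset.mul_sum]
        refine Finset.sum_congr rfl fun s _ => ?_
        rw [Finset.prod_div_distrib]
        ring
    _ = _ := by rw [Finset.prod_one_add]

theorem exists_sum_div_totient_sq_le :
    ∃ K : ℝ, 0 < K ∧ ∀ x : ℕ, ∑ d ∈ Finset.Icc 1 x, ((d : ℝ) / Nat.totient d) ^ 2 ≤ K * x := by
  have hs : Summable fun n : ℕ => 1 / (n : ℝ) ^ 2 := Real.summable_one_div_nat_pow.2 (by norm_num)
  refine ⟨Real.exp (8 * ∑' n : ℕ, 1 / (n : ℝ) ^ 2), Real.exp_pos _, fun x => ?_⟩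
  set h : ℕ → ℝ := fun p => ((1 - (p : ℝ)⁻¹)⁻¹) ^ 2 - 1 with hh
  have hp2 : ∀ p : ℕ, p.Prime → (2 : ℝ) ≤ p := fun p hp => by exact_mod_cast hp.two_le
  have h0 : ∀ p, p.Prime → 0 ≤ h p := by
    intro p hp
    have h1 : (p : ℝ)⁻¹ < 1 := inv_lt_one_of_one_lt₀ (by linarith [hp2 p hp])
    have h2 : (1 : ℝ) ≤ (1 - (p : ℝ)⁻¹)⁻¹ := by
      refine (one_le_inv₀ (by linarith)).2 ?_
      have : (0 : ℝ) ≤ (p : ℝ)⁻¹ := by positivity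
      linarith
    have := one_le_pow₀ h2 (n := 2)
    simp only [hh]
    linarith
  have e : ∀ d ∈ Finset.Icc 1 x, ((d : ℝ) / Nat.totient d) ^ 2 =
      ∏ p ∈ d.primeFactors, (1 + h p) := by
    intro d hd
    rw [Finset.mem_Icc] at hd
    rw [← prod_primeFactors_inv_one_sub_inv (by omega), ← Finset.prod_pow]
    refine Finset.prod_congr rfl fun p _ => ?_
    simp only [hh]
    ring
  rw [Finset.sum_congr rfl e, mul_comm]
  refine (sum_prod_primeFactors_one_add_le h0 x).trans ?_
  gcongr
  calc ∏ p ∈ (Finset.Icc 1 x).filter Nat.Prime, (1 + h p / p)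
      ≤ ∏ p ∈ (Finset.Icc 1 x).filter Nat.Prime, Real.exp (8 * (1 / (p : ℝ) ^ 2)) := by
        refine Finset.prod_le_prod (fun p hp => ?_) fun p hp => ?_
        · have := h0 p (Finset.mem_filter.1 hp).2
          positivity
        · have h2 := hp2 p (Finset.mem_filter.1 hp).2
          have : h p / p ≤ 8 * (1 / (p : ℝ) ^ 2) := by
            have h3 : (0 : ℝ) < p - 1 := by linarith
            have e1 : h p / p = (2 * p - 1) / ((p - 1) ^ 2 * p) := by
              simp only [hh]
              have h4 : (p : ℝ) ≠ 0 := by linarith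
              have h5 : (1 : ℝ) - (p : ℝ)⁻¹ = (p - 1) / p := by field_simp
              rw [h5]
              field_simp
              ring
            rw [e1, mul_one_div, div_le_div_iff₀ (by positivity) (by positivity)]
            have h6 : (0 : ℝ) ≤ 6 * p ^ 2 - 15 * p + 8 := by nlinarith
            nlinarith [mul_nonneg (by linarith : (0 : ℝ) ≤ p) h6]
          have := Real.add_one_le_exp (8 * (1 / (p : ℝ) ^ 2))
          linarith
    _ = Real.exp (8 * ∑ p ∈ (Finset.Icc 1 x).filter Nat.Prime, 1 / (p : ℝ) ^ 2) := by
        rw [← Real.exp_sum, Finset.mul_sum]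
    _ ≤ _ := by
        gcongr
        exact hs.sum_le_tsum _ fun _ _ => by positivity

/-- The odd primes below `X`. -/
def oddPrimesBelow (X : ℕ) : Finset ℕ := (Finset.range X).filter fun p => p.Prime ∧ p ≠ 2

theorem mem_oddPrimesBelow {X p : ℕ} : p ∈ oddPrimesBelow X ↔ p < X ∧ p.Prime ∧ p ≠ 2 := by
  simp [oddPrimesBelow]

theorem le_card_oddPrimesBelow {y : ℕ} (hy : 2 ≤ y) :
    ((y ^ 16 : ℕ) : ℝ) / (64 * Real.log y) ≤ ((oddPrimesBelow (y ^ 16)).card : ℝ) - 1 := by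
  have hy' : (2 : ℝ) ≤ y := by exact_mod_cast hy
  have hlog : 0 < Real.log y := Real.log_pos (by linarith)
  have hlogle : Real.log y ≤ y := Real.log_le_self (by linarith)
  set X : ℕ := y ^ 16 with hX
  have hXr : (X : ℝ) = y ^ 16 := by rw [hX]; push_cast; ring
  have hlogX : Real.log X = 16 * Real.log y := by rw [hXr, Real.log_pow]; norm_num
  have hX1 : (2 : ℝ) ^ 15 * y ≤ X := by
    rw [hXr]
    calc (2 : ℝ) ^ 15 * y ≤ (y : ℝ) ^ 15 * y := by gcongr
      _ = (y : ℝ) ^ 16 := by ring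
  have hpi := Chebyshev.pi_ge X
  rw [div_le_iff₀ (by rw [hlogX]; positivity)] at hpi
  have hcard : Nat.primeCounting X ≤ (oddPrimesBelow X).card + 2 := by
    rw [Nat.primeCounting, Nat.primeCounting', Nat.count_eq_card_filter_range]
    have : (Finset.range (X + 1)).filter Nat.Prime ⊆ oddPrimesBelow X ∪ {2, X} := by
      intro p hp
      simp only [Finset.mem_filter, Finset.mem_range, Finset.mem_union, mem_oddPrimesBelow,
        Finset.mem_insert, Finset.mem_singleton] at hp ⊢
      by_cases h2 : p = 2
      · tauto
      · by_cases h3 : p = X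
        · tauto
        · exact Or.inl ⟨by omega, hp.2, h2⟩
    refine (Finset.card_le_card this).trans ((Finset.card_union_le _ _).trans ?_)
    gcongr
    exact Finset.card_le_two
  have hcard' : (Nat.primeCounting X : ℝ) ≤ (oddPrimesBelow X).card + 2 := by exact_mod_cast hcard
  have hl1 : Real.log (X + 1) ≤ 1 + Real.log X := by
    have : Real.log (X + 1) ≤ Real.log (2 * X) :=
      Real.log_le_log (by positivity) (by linarith)
    rw [Real.log_mul (by norm_num) (by linarith)] at this
    have := Real.log_two_lt_d9
    linarith
  have hl2 := Real.log_two_gt_d9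
  rw [div_le_iff₀ (by positivity)]
  rw [hlogX] at hpi hl1
  have h5 : (Nat.primeCounting X : ℝ) * (16 * Real.log y) ≤
      ((oddPrimesBelow X).card + 2) * (16 * Real.log y) := by gcongr
  nlinarith

theorem card_pairs_lt (P : Finset ℕ) :
    2 * ((P ×ˢ P).filter fun x => x.1 < x.2).card = P.card * P.card - P.card := by
  have h1 : ((P ×ˢ P).filter fun x => x.2 < x.1).card =
      ((P ×ˢ P).filter fun x => x.1 < x.2).card := by
    refine Finset.card_nbij' Prod.swap Prod.swap ?_ ?_ (fun _ _ => rfl) (fun _ _ => rfl)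
    · intro x hx
      simp only [Finset.coe_filter, Finset.mem_product, Set.mem_ofPred_eq] at hx ⊢
      exact ⟨⟨hx.1.2, hx.1.1⟩, hx.2⟩
    · intro x hx
      simp only [Finset.coe_filter, Finset.mem_product, Set.mem_ofPred_eq] at hx ⊢
      exact ⟨⟨hx.1.2, hx.1.1⟩, hx.2⟩
  rw [two_mul]
  nth_rewrite 2 [← h1]
  rw [← Finset.offDiag_card, ← Finset.card_union_of_disjoint]
  · congr 1
    ext x
    simp only [Finset.mem_union, Finset.mem_filter, Finset.mem_product, Finset.mem_offDiag]
    constructor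
    · rintro (h | h)
      · exact ⟨h.1.1, h.1.2, h.2.ne⟩
      · exact ⟨h.1.1, h.1.2, h.2.ne'⟩
    · rintro ⟨h1, h2, h3⟩
      rcases lt_or_gt_of_ne h3 with h | h
      · exact Or.inl ⟨⟨h1, h2⟩, h⟩
      · exact Or.inr ⟨⟨h1, h2⟩, h⟩
  · rw [Finset.disjoint_left]
    intro x hx hx'
    exact lt_asymm (Finset.mem_filter.1 hx).2 (Finset.mem_filter.1 hx').2

/-- The lower terms of the pairs of odd primes below `X` with difference `d`. -/
def primePairs (X d : ℕ) : Finset ℕ :=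
  (oddPrimesBelow X).filter fun q => q + d ∈ oddPrimesBelow X

theorem le_sum_card_primePairs {y : ℕ} (hy : 2 ≤ y) :
    ((y ^ 16 : ℕ) : ℝ) ^ 2 / (8192 * Real.log y ^ 2) ≤
      ∑ d ∈ Finset.Icc 1 (y ^ 16), ((primePairs (y ^ 16) d).card : ℝ) := by
  have h1 := le_card_oddPrimesBelow hy
  set P := oddPrimesBelow (y ^ 16) with hP
  have hlog : 0 < Real.log y := Real.log_pos (by exact_mod_cast hy)
  have h2 := card_pairs_lt P
  have h3 : ((P ×ˢ P).filter fun x => x.1 < x.2).card ≤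
      ∑ d ∈ Finset.Icc 1 (y ^ 16), (primePairs (y ^ 16) d).card := by
    have hmaps : ∀ x ∈ (P ×ˢ P).filter (fun x => x.1 < x.2), x.2 - x.1 ∈ Finset.Icc 1 (y ^ 16) := by
      intro x hx
      simp only [Finset.mem_filter, Finset.mem_product, hP, mem_oddPrimesBelow] at hx
      rw [Finset.mem_Icc]
      omega
    rw [Finset.card_eq_sum_card_fiberwise hmaps]
    refine Finset.sum_le_sum fun d _ => ?_
    refine Finset.card_le_card_of_injOn (fun x => x.1) ?_ ?_
    · intro x hx
      simp only [Finset.coe_filter, Finset.mem_filter, Finset.mem_product,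
        Set.mem_ofPred_eq] at hx
      obtain ⟨⟨⟨ha, hb⟩, hlt⟩, hd⟩ := hx
      refine Finset.mem_coe.2 (Finset.mem_filter.2 ⟨ha, ?_⟩)
      have e : x.1 + d = x.2 := by omega
      rw [e]
      exact hb
    · intro x hx z hz hxz
      simp only [Finset.coe_filter, Finset.mem_filter, Finset.mem_product,
        Set.mem_ofPred_eq] at hx hz hxz
      refine Prod.ext hxz ?_
      omega
  have h4 : (((P ×ˢ P).filter fun x => x.1 < x.2).card : ℝ) ≤
      ∑ d ∈ Finset.Icc 1 (y ^ 16), ((primePairs (y ^ 16) d).card : ℝ) := by exact_mod_cast h3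
  refine le_trans ?_ h4
  have h5 : 2 * (((P ×ˢ P).filter fun x => x.1 < x.2).card : ℝ) = P.card * P.card - P.card := by
    have := congrArg (Nat.cast : ℕ → ℝ) h2
    rw [Nat.cast_sub (Nat.le_mul_self _)] at this
    push_cast at this
    exact this
  set t := ((y ^ 16 : ℕ) : ℝ) / (64 * Real.log y) with ht
  have ht0 : 0 ≤ t := by positivity
  have e : ((y ^ 16 : ℕ) : ℝ) ^ 2 / (8192 * Real.log y ^ 2) = t ^ 2 / 2 := by
    rw [ht]; field_simp; norm_num
  rw [e]
  nlinarith

theorem primePairs_eq_empty {X d : ℕ} (hd : ¬ 2 ∣ d) : primePairs X d = ∅ := by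
  refine Finset.filter_eq_empty_iff.2 fun q hq h => hd ?_
  rw [mem_oddPrimesBelow] at hq h
  have h1 := hq.2.1.eq_two_or_odd'.resolve_left hq.2.2
  have h2 := h.2.1.eq_two_or_odd'.resolve_left h.2.2
  exact even_iff_two_dvd.1 ((Nat.odd_add.1 h2).1 h1)

theorem one_le_div_totient {d : ℕ} (hd : 0 < d) : (1 : ℝ) ≤ d / Nat.totient d := by
  rw [one_le_div (by exact_mod_cast Nat.totient_pos.2 hd)]
  exact_mod_cast Nat.totient_le d

theorem card_primePairs_le {d : ℕ} (hd : 0 < d) {y : ℕ} (hy : 2 ≤ y) :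
    ((primePairs (y ^ 16) d).card : ℝ) ≤
      3 * (y ^ 16 : ℕ) / Real.log y ^ 2 * (d / Nat.totient d) := by
  have hy' : (2 : ℝ) ≤ y := by exact_mod_cast hy
  have hlog : 0 < Real.log y := Real.log_pos (by linarith)
  have hlogle : Real.log y ≤ y := Real.log_le_self (by linarith)
  have ht := one_le_div_totient hd
  by_cases hd2 : 2 ∣ d
  · set A := (primePairs (y ^ 16) d).filter fun q => y ^ 2 < q with hA
    have hAsub : A ⊆ Finset.range (y ^ 16) := by
      intro q hq
      simp only [hA, primePairs, Finset.mem_filter, mem_oddPrimesBelow] at hq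
      exact Finset.mem_range.2 hq.1.1.1
    have h1 := card_sieved_le hd hd2 hy hAsub ?_
    · have h2 : (primePairs (y ^ 16) d).card ≤ A.card + y ^ 2 := by
        rw [← Finset.card_filter_add_card_filter_not (s := primePairs (y ^ 16) d)
          (fun q => y ^ 2 < q)]
        gcongr
        calc _ ≤ (Finset.Icc 1 (y ^ 2)).card := by
              refine Finset.card_le_card fun q hq => ?_
              simp only [primePairs, Finset.mem_filter, mem_oddPrimesBelow] at hq
              exact Finset.mem_Icc.2 ⟨hq.1.1.2.1.one_le, not_lt.1 hq.2⟩
          _ = _ := by simp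
      have h2' : ((primePairs (y ^ 16) d).card : ℝ) ≤ A.card + (y : ℝ) ^ 2 := by exact_mod_cast h2
      set t := (d : ℝ) / Nat.totient d
      have h3 : (y : ℝ) ^ 14 ≤ (y ^ 16 : ℕ) / Real.log y ^ 2 * t := by
        calc (y : ℝ) ^ 14 = (y ^ 16 : ℕ) / (y : ℝ) ^ 2 * 1 := by push_cast; field_simp
          _ ≤ _ := by gcongr
      have h4 : (y : ℝ) ^ 12 ≤ y ^ 14 := pow_le_pow_right₀ (by linarith) (by norm_num)
      have h5 : (y : ℝ) ^ 2 ≤ y ^ 14 := pow_le_pow_right₀ (by linarith) (by norm_num)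
      have e1 : ((y ^ 16 : ℕ) : ℝ) * t / Real.log y ^ 2 = (y ^ 16 : ℕ) / Real.log y ^ 2 * t := by
        ring
      have e2 : 3 * ((y ^ 16 : ℕ) : ℝ) / Real.log y ^ 2 * t =
        3 * ((y ^ 16 : ℕ) / Real.log y ^ 2 * t) := by ring
      rw [e1] at h1
      rw [e2]
      linarith
    · intro q hq p hp hpy hdvd
      simp only [hA, primePairs, Finset.mem_filter, mem_oddPrimesBelow] at hq
      rcases hp.dvd_mul.1 hdvd with h | h
      · have := (Nat.prime_dvd_prime_iff_eq hp hq.1.1.2.1).1 h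
        omega
      · have := (Nat.prime_dvd_prime_iff_eq hp hq.1.2.2.1).1 h
        omega
  · rw [primePairs_eq_empty hd2, Finset.card_empty, Nat.cast_zero]
    positivity

/-- The differences `d` of two primes at most `C * d`, with `φ(d) ≥ κ d`. -/
def primeDifferences (κ : ℝ) (C : ℕ) : Set ℕ :=
  {d | κ * d ≤ Nat.totient d ∧ ∃ q, q.Prime ∧ (q + d).Prime ∧ q + d ≤ C * d}

open Classical in
theorem exists_le_card_primeDifferences_pow :
    ∃ κ : ℝ, 0 < κ ∧ ∃ C : ℕ, 0 < C ∧ ∃ c₀ : ℝ, 0 < c₀ ∧ ∀ y : ℕ, 2 ≤ y →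
      c₀ * (y ^ 16 : ℕ) ≤
        (((Finset.Icc 1 (y ^ 16)).filter (· ∈ primeDifferences κ C)).card : ℝ) := by
  obtain ⟨K, hK, hKx⟩ := exists_sum_div_totient_sq_le
  set c₁ : ℝ := 1 / 24576 with hc₁
  set T : ℝ := 2 * K / c₁ with hT
  have hT0 : 0 < T := by positivity
  set c₀ : ℝ := c₁ / (4 * T) with hc₀
  have hc00 : 0 < c₀ := by positivity
  refine ⟨1 / T, by positivity, ⌈1 / c₀⌉₊, Nat.ceil_pos.2 (by positivity), c₀, hc00,
    fun y hy => ?_⟩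
  have hlog : 0 < Real.log y := Real.log_pos (by exact_mod_cast hy)
  have hlow := le_sum_card_primePairs hy
  have hup : ∀ d ∈ Finset.Icc 1 (y ^ 16), _ := fun d hd =>
    card_primePairs_le (Nat.lt_of_lt_of_le one_pos (Finset.mem_Icc.1 hd).1) hy
  have hX0 : 0 < y ^ 16 := by positivity
  set X := y ^ 16 with hX
  have hXr : (0 : ℝ) < X := by exact_mod_cast hX0
  have hKX := hKx X
  set t : ℕ → ℝ := fun d => (d : ℝ) / Nat.totient d with ht
  have ht0 : ∀ d, 0 ≤ t d := fun d => by positivity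
  set E := (Finset.Icc 1 X).filter fun d => (primePairs X d).Nonempty with hE
  have hEsum : c₁ * X ≤ ∑ d ∈ E, t d := by
    have h1 : ∑ d ∈ Finset.Icc 1 X, ((primePairs X d).card : ℝ) ≤
        ∑ d ∈ E, 3 * (X : ℝ) / Real.log y ^ 2 * t d := by
      rw [hE, Finset.sum_filter]
      refine Finset.sum_le_sum fun d hd => ?_
      split_ifs with h
      · exact hup d hd
      · rw [Finset.not_nonempty_iff_eq_empty] at h
        simp [h]
    rw [← Finset.mul_sum] at h1
    have h2 := hlow.trans h1
    have e : (X : ℝ) ^ 2 / (8192 * Real.log y ^ 2) =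
        3 * (X : ℝ) / Real.log y ^ 2 * (c₁ * X) := by
      rw [hc₁]; field_simp; norm_num
    rw [e] at h2
    exact le_of_mul_le_mul_left h2 (by positivity)
  have hsplit : ∑ d ∈ E, t d ≤ T * ((E.filter fun d => t d ≤ T).card : ℝ) + c₁ / 2 * X := by
    rw [← Finset.sum_filter_add_sum_filter_not E (fun d => t d ≤ T)]
    refine add_le_add ?_ ?_
    · rw [mul_comm, ← nsmul_eq_mul, ← Finset.sum_const]
      exact Finset.sum_le_sum fun d hd => (Finset.mem_filter.1 hd).2
    · calc ∑ d ∈ E.filter (fun d => ¬ t d ≤ T), t d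
          ≤ ∑ d ∈ E.filter (fun d => ¬ t d ≤ T), t d ^ 2 / T := by
            refine Finset.sum_le_sum fun d hd => ?_
            have := not_le.1 (Finset.mem_filter.1 hd).2
            rw [le_div_iff₀ hT0, pow_two]
            exact mul_le_mul_of_nonneg_left this.le (ht0 d)
        _ ≤ ∑ d ∈ Finset.Icc 1 X, t d ^ 2 / T :=
            Finset.sum_le_sum_of_subset_of_nonneg
              ((Finset.filter_subset _ _).trans (Finset.filter_subset _ _))
              fun _ _ _ => by positivity
        _ ≤ K * X / T := by
            rw [← Finset.sum_div]
            gcongr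
        _ = c₁ / 2 * X := by rw [hT]; field_simp
  have hcard : 2 * c₀ * X ≤ ((E.filter fun d => t d ≤ T).card : ℝ) := by
    have h1 : T * (2 * c₀ * X) ≤ T * ((E.filter fun d => t d ≤ T).card : ℝ) := by
      have e : T * (2 * c₀ * X) = c₁ / 2 * X := by rw [hc₀]; field_simp; norm_num
      rw [e]
      have := hEsum.trans hsplit
      linarith
    exact le_of_mul_le_mul_left h1 hT0
  set F := (Finset.Icc 1 X).filter (· ∈ primeDifferences (1 / T) ⌈1 / c₀⌉₊) with hF
  have hsub : E.filter (fun d => t d ≤ T) ⊆ F ∪ Finset.Icc 1 ⌊c₀ * X⌋₊ := by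
    intro d hd
    simp only [hE, Finset.mem_filter, Finset.mem_Icc] at hd
    obtain ⟨⟨hdX, q, hq⟩, hdT⟩ := hd
    simp only [Finset.mem_union, hF, Finset.mem_filter, Finset.mem_Icc]
    by_cases hsmall : d ≤ ⌊c₀ * X⌋₊
    · exact Or.inr ⟨hdX.1, hsmall⟩
    · left
      have hlt : c₀ * X < d := (Nat.floor_lt (by positivity)).1 (not_le.1 hsmall)
      have hφ : (0 : ℝ) < Nat.totient d := by exact_mod_cast Nat.totient_pos.2 hdX.1
      simp only [primePairs, Finset.mem_filter, mem_oddPrimesBelow] at hq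
      refine ⟨hdX, ?_, q, hq.1.2.1, hq.2.2.1, ?_⟩
      · rw [ht, div_le_iff₀ hφ] at hdT
        rw [one_div, inv_mul_le_iff₀ hT0]
        exact hdT
      · have h1 : ((q + d : ℕ) : ℝ) ≤ (⌈1 / c₀⌉₊ * d : ℕ) := by
          have h2 : ((q + d : ℕ) : ℝ) ≤ X := by exact_mod_cast hq.2.1.le
          have h3 : 1 / c₀ ≤ ⌈1 / c₀⌉₊ := Nat.le_ceil _
          calc ((q + d : ℕ) : ℝ) ≤ 1 / c₀ * (c₀ * X) := by
                rw [← mul_assoc, one_div, inv_mul_cancel₀ hc00.ne', one_mul]; exact h2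
            _ ≤ ⌈1 / c₀⌉₊ * d := by gcongr
            _ = _ := by push_cast; ring
        exact_mod_cast h1
  have hle := (Finset.card_le_card hsub).trans (Finset.card_union_le _ _)
  rw [Nat.card_Icc, Nat.add_sub_cancel] at hle
  have hle' : ((E.filter fun d => t d ≤ T).card : ℝ) ≤ F.card + ⌊c₀ * X⌋₊ := by exact_mod_cast hle
  have := Nat.floor_le (a := c₀ * X) (by positivity)
  linarith

open Classical in
theorem exists_le_card_primeDifferences :
    ∃ κ : ℝ, 0 < κ ∧ ∃ C : ℕ, 0 < C ∧ ∃ c₀ : ℝ, 0 < c₀ ∧ ∃ K : ℝ, ∀ x : ℕ,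
      c₀ * x - K ≤ (((Finset.Icc 1 x).filter (· ∈ primeDifferences κ C)).card : ℝ) := by
  obtain ⟨κ, hκ, C, hC, c₀, hc₀, h⟩ := exists_le_card_primeDifferences_pow
  refine ⟨κ, hκ, C, hC, c₀ / 2 ^ 16, by positivity, c₀, fun x => ?_⟩
  by_cases hx : x < 2 ^ 16
  · have : (x : ℝ) ≤ 2 ^ 16 := by exact_mod_cast hx.le
    have h1 : c₀ / 2 ^ 16 * x ≤ c₀ := by
      calc c₀ / 2 ^ 16 * x ≤ c₀ / 2 ^ 16 * 2 ^ 16 := by gcongr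
        _ = c₀ := by field_simp
    exact (sub_nonpos.2 h1).trans (by positivity)
  · rw [not_lt] at hx
    set y := Nat.findGreatest (fun y => y ^ 16 ≤ x) x with hy
    have hy1 : y ^ 16 ≤ x := Nat.findGreatest_spec (P := fun y => y ^ 16 ≤ x) (m := 2)
      (by omega) hx
    have hy2 : 2 ≤ y := Nat.le_findGreatest (by omega) hx
    have hy3 : x < (y + 1) ^ 16 := by
      by_contra! hcon
      have : y + 1 ≤ y := Nat.le_findGreatest
        ((Nat.le_self_pow (by norm_num) _).trans hcon) hcon
      omega
    have hy4 : x ≤ 2 ^ 16 * y ^ 16 := by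
      rw [← mul_pow]
      exact hy3.le.trans (Nat.pow_le_pow_left (by omega) 16)
    have hy5 : (x : ℝ) ≤ 2 ^ 16 * (y ^ 16 : ℕ) := by exact_mod_cast hy4
    have hmono := Finset.card_le_card (Finset.filter_subset_filter
      (· ∈ primeDifferences κ C)
      (Finset.Icc_subset_Icc_right (a := 1) hy1))
    calc c₀ / 2 ^ 16 * x - c₀ ≤ c₀ / 2 ^ 16 * x := by linarith
      _ ≤ c₀ / 2 ^ 16 * (2 ^ 16 * (y ^ 16 : ℕ)) := by gcongr
      _ = c₀ * (y ^ 16 : ℕ) := by field_simp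
      _ ≤ _ := h y hy2
      _ ≤ _ := by exact_mod_cast hmono

open Classical in
theorem not_summable_indicator_of_le_card {η : ℕ → ℝ} (hη : ∀ n, 0 ≤ η n)
    (hanti : ∀ n, 1 ≤ n → η (n + 1) ≤ η n) (hdiv : ¬ Summable η) {D : Set ℕ} {c₀ K : ℝ}
    (hc₀ : 0 < c₀)
    (hD : ∀ x : ℕ, c₀ * x - K ≤ (((Finset.Icc 1 x).filter (· ∈ D)).card : ℝ)) :
    ¬ Summable (D.indicator η) := by
  intro hsum
  have hK : 0 ≤ K := by simpa using hD 0
  set b : ℕ → ℝ := fun d => (if d ∈ D then 1 else 0) - c₀ with hb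
  have hB : ∀ n, -K ≤ ∑ d ∈ Finset.Icc 1 n, b d := by
    intro n
    have := hD n
    rw [Finset.card_filter] at this
    push_cast at this
    simp only [hb, Finset.sum_sub_distrib, Finset.sum_const, Nat.card_Icc, Nat.add_sub_cancel,
      nsmul_eq_mul]
    linarith
  have habel : ∀ n, 1 ≤ n → (∑ d ∈ Finset.Icc 1 n, b d + K) * η n - K * η 1 ≤
      ∑ d ∈ Finset.Icc 1 n, b d * η d := by
    intro n hn
    induction n, hn using Nat.le_induction with
    | base => simp only [Finset.Icc_self, Finset.sum_singleton]; linarith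
    | succ n hn ih =>
      rw [Finset.sum_Icc_succ_top (by omega), Finset.sum_Icc_succ_top (by omega)]
      have := mul_le_mul_of_nonneg_left (hanti n hn) (by linarith [hB n] :
        0 ≤ ∑ d ∈ Finset.Icc 1 n, b d + K)
      linarith
  have hind : ∀ n, ∑ d ∈ Finset.Icc 1 n, b d * η d =
      ∑ d ∈ Finset.Icc 1 n, D.indicator η d - c₀ * ∑ d ∈ Finset.Icc 1 n, η d := by
    intro n
    rw [Finset.mul_sum, ← Finset.sum_sub_distrib]
    refine Finset.sum_congr rfl fun d _ => ?_
    simp only [hb, Set.indicator]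
    split_ifs <;> ring
  refine hdiv (summable_of_sum_range_le (c := η 0 + (∑' d, D.indicator η d + K * η 1) / c₀) hη
    fun n => ?_)
  have h1 : ∑ d ∈ Finset.range n, η d ≤ η 0 + ∑ d ∈ Finset.Icc 1 (n + 1), η d := by
    rw [← Finset.sum_insert (a := 0) (s := Finset.Icc 1 (n + 1)) (by simp)]
    refine Finset.sum_le_sum_of_subset_of_nonneg (fun d hd => ?_) fun d _ _ => hη d
    rw [Finset.mem_range] at hd
    rw [Finset.mem_insert, Finset.mem_Icc]
    omega
  have h2 := habel (n + 1) (by omega)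
  rw [hind] at h2
  have h3 := mul_nonneg (by linarith [hB (n + 1)] :
    0 ≤ ∑ d ∈ Finset.Icc 1 (n + 1), b d + K) (hη (n + 1))
  have h4 := hsum.sum_le_tsum (Finset.Icc 1 (n + 1))
    fun d _ => Set.indicator_nonneg (fun d _ => hη d) d
  have h5 : ∑ d ∈ Finset.Icc 1 (n + 1), η d ≤ (∑' d, D.indicator η d + K * η 1) / c₀ := by
    rw [le_div_iff₀ hc₀]
    linarith
  linarith

theorem nthPrime_primeCounting {p : ℕ} (hp : p.Prime) : nthPrime (Nat.primeCounting p) = p := by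
  rw [nthPrime, Nat.primeCounting, Nat.primeCounting', Nat.count_succ, if_pos hp,
    Nat.add_sub_cancel, Nat.nth_count hp]

theorem one_le_primeCounting {p : ℕ} (hp : p.Prime) : 1 ≤ Nat.primeCounting p := by
  rw [Nat.primeCounting, Nat.primeCounting', Nat.count_succ, if_pos hp]
  omega

theorem deltaMin_nthPrime_le {d q M : ℕ} (hd : 0 < d) (hq : q.Prime) (hqd : (q + d).Prime)
    (hM : q + d ≤ M) (α : ℝ) : deltaMin nthPrime α (Nat.primeCounting M) ≤ nint (d * α) := by
  refine csInf_le ⟨0, ?_⟩ ⟨Nat.primeCounting (q + d), Nat.primeCounting q,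
    one_le_primeCounting hqd, Nat.monotone_primeCounting hM, one_le_primeCounting hq,
    Nat.monotone_primeCounting (by omega), fun h => ?_, ?_⟩
  · rintro x ⟨m, n, _, _, _, _, _, rfl⟩
    exact abs_nonneg _
  · have := congrArg nthPrime h
    rw [nthPrime_primeCounting hq, nthPrime_primeCounting hqd] at this
    omega
  · rw [nthPrime_primeCounting hq, nthPrime_primeCounting hqd]
    push_cast
    rw [add_sub_cancel_left]

theorem primeCounting_mul_L_le {x : ℕ} (hx : 2 ≤ x) :
    (Nat.primeCounting x : ℝ) * L (Nat.primeCounting x) ≤ 5 * x := by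
  have hx' : (2 : ℝ) ≤ x := by exact_mod_cast hx
  have hπ0 : (1 : ℝ) ≤ Nat.primeCounting x := by
    exact_mod_cast (one_le_primeCounting Nat.prime_two).trans (Nat.monotone_primeCounting hx)
  have hπx : (Nat.primeCounting x : ℝ) ≤ x := by
    have : Nat.primeCounting x ≤ x := by
      rw [Nat.primeCounting, Nat.primeCounting', Nat.count_eq_card_filter_range]
      calc _ ≤ (Finset.Icc 1 x).card := by
            refine Finset.card_le_card fun p hp => ?_
            rw [Finset.mem_filter, Finset.mem_range] at hp
            rw [Finset.mem_Icc]
            exact ⟨hp.2.one_le, by omega⟩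
        _ = x := by simp
    exact_mod_cast this
  have hmax : L (Nat.primeCounting x) ≤ max 1 (Real.log x) :=
    max_le_max le_rfl (Real.log_le_log (by linarith) hπx)
  refine (mul_le_mul_of_nonneg_left hmax (by linarith)).trans ?_
  rcases max_choice 1 (Real.log x) with h | h
  · rw [h]; linarith
  · rw [h]
    have hs : 0 < √(x : ℝ) := Real.sqrt_pos.2 (by linarith)
    have hs1 : 1 < √(x : ℝ) := by
      rw [Real.lt_sqrt (by norm_num)]; linarith
    have hss : √(x : ℝ) * √(x : ℝ) = x := Real.mul_self_sqrt (by linarith)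
    have hlogx : Real.log x = 2 * Real.log √(x : ℝ) := by
      rw [Real.log_sqrt (by linarith)]; ring
    have hls : 0 < Real.log √(x : ℝ) := Real.log_pos hs1
    have hls2 : Real.log √(x : ℝ) ≤ √(x : ℝ) := Real.log_le_self hs.le
    have hl4 : Real.log 4 ≤ 1.5 := by
      have : (4 : ℝ) = 2 ^ 2 := by norm_num
      rw [this, Real.log_pow]
      have := Real.log_two_lt_d9
      push_cast
      linarith
    have hπ := Chebyshev.pi_le_log4_mul_div (x := x) (by linarith)
    rw [Nat.floor_natCast] at hπ
    rw [hlogx]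
    calc (Nat.primeCounting x : ℝ) * (2 * Real.log √(x : ℝ))
        ≤ (Real.log 4 * x / Real.log √(x : ℝ) + √(x : ℝ)) * (2 * Real.log √(x : ℝ)) := by gcongr
      _ = 2 * Real.log 4 * x + 2 * (√(x : ℝ) * Real.log √(x : ℝ)) := by field_simp
      _ ≤ 2 * 1.5 * x + 2 * (√(x : ℝ) * √(x : ℝ)) := by gcongr
      _ = 5 * x := by rw [hss]; ring

theorem exists_mul_le_apply_mul {η : ℕ → ℝ} (hη : ∀ N, 0 ≤ η N)
    (hanti : ∀ m n : ℕ, 1 ≤ m → m ≤ n → η n ≤ η m) {c : ℝ} (hc : 0 < c)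
    (hreg : ∀ N : ℕ, 1 ≤ N → c * η N ≤ η (2 * N)) {C : ℕ} (hC : 0 < C) :
    ∃ c₁ : ℝ, 0 < c₁ ∧ (∀ d, 1 ≤ d → c₁ * η d ≤ η (C * d)) ∧ ∀ d, 1 ≤ d → c₁ * η d ≤ 1 / 2 := by
  have hpow : ∀ j d : ℕ, 1 ≤ d → c ^ j * η d ≤ η (2 ^ j * d) := by
    intro j d hd
    induction j with
    | zero => simp
    | succ j ih =>
      calc c ^ (j + 1) * η d = c * (c ^ j * η d) := by ring
        _ ≤ c * η (2 ^ j * d) := by gcongr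
        _ ≤ η (2 * (2 ^ j * d)) := hreg _ (Nat.mul_pos (by positivity) hd)
        _ = _ := by congr 1; ring
  have h1 : 0 < 2 * (η 1 + 1) := by linarith [hη 1]
  refine ⟨min (c ^ C) (1 / (2 * (η 1 + 1))), lt_min (by positivity) (by positivity),
    fun d hd => ?_, fun d hd => ?_⟩
  · calc _ ≤ c ^ C * η d := mul_le_mul_of_nonneg_right (min_le_left _ _) (hη d)
      _ ≤ η (2 ^ C * d) := hpow C d hd
      _ ≤ η (C * d) := hanti _ _ (Nat.mul_pos hC hd)
        (Nat.mul_le_mul_right _ Nat.lt_two_pow_self.le)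
  · calc _ ≤ 1 / (2 * (η 1 + 1)) * η d := mul_le_mul_of_nonneg_right (min_le_right _ _) (hη d)
      _ ≤ 1 / (2 * (η 1 + 1)) * (η 1 + 1) := by
        have := hanti 1 d le_rfl hd
        gcongr
        linarith
      _ = 1 / 2 := by
        have : η 1 + 1 ≠ 0 := by linarith
        field_simp

theorem stmt7 (η : ℕ → ℝ) (hη : ∀ N, 0 ≤ η N)
    (hdec : ∀ m n : ℕ, 1 ≤ m → m < n → η n < η m)
    (c : ℝ) (hc : 0 < c) (hreg : ∀ N : ℕ, 1 ≤ N → c * η N ≤ η (2 * N))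
    (hdiv : ¬ Summable η) :
    volume {α : ℝ | α ∈ Set.Icc (0 : ℝ) 1 ∧
      (∃ᶠ N in atTop, deltaMin nthPrime α N ≤ η ⌊(N : ℝ) * L N⌋₊)} = 1 := by
  have hanti : ∀ m n : ℕ, 1 ≤ m → m ≤ n → η n ≤ η m := fun m n hm hmn =>
    hmn.eq_or_lt.elim (fun h => h ▸ le_rfl) fun h => (hdec m n hm h).le
  obtain ⟨κ, hκ, C, hC, c₀, hc₀, K, hD⟩ := exists_le_card_primeDifferences
  obtain ⟨c₁, hc₁, hη₁, hη₂⟩ := exists_mul_le_apply_mul hη hanti hc hreg (C := 5 * C) (by omega)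
  set D := primeDifferences κ C with hDdef
  have hD0 : ∀ d ∈ D, 1 ≤ d := by
    rintro d ⟨-, q, hq, -, hqd⟩
    by_contra! h
    obtain rfl : d = 0 := by omega
    have := hq.pos
    omega
  have hψ0 : ∀ d, 0 ≤ c₁ * D.indicator η d := fun d =>
    mul_nonneg hc₁.le (Set.indicator_nonneg (fun d _ => hη d) d)
  have hae := ae_frequently_nint_lt (ψ := fun d => c₁ * D.indicator η d) hψ0 (fun d => ?_)
    (fun h => ?_) hκ (fun d hd => ?_)
  · have hsub : ∀ᵐ α : ℝ, α ∈ Set.Ioc (0 : ℝ) 1 → α ∈ {α : ℝ | α ∈ Set.Icc (0 : ℝ) 1 ∧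
        (∃ᶠ N in atTop, deltaMin nthPrime α N ≤ η ⌊(N : ℝ) * L N⌋₊)} := by
      filter_upwards [(ae_restrict_iff' measurableSet_Ioc).1 hae] with α hα hα01
      refine ⟨Set.Ioc_subset_Icc_self hα01, ?_⟩
      have htend : Tendsto (fun d => Nat.primeCounting (C * d)) atTop atTop :=
        Nat.tendsto_primeCounting.comp (tendsto_id.const_mul_atTop' hC)
      refine htend.frequently ((hα hα01).mono fun d hd => ?_)
      have hdD : d ∈ D := by
        by_contra hdD
        rw [Set.indicator_of_notMem hdD, mul_zero] at hd
        exact absurd hd (not_lt.2 (abs_nonneg _))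
      rw [Set.indicator_of_mem hdD] at hd
      have hd1 := hD0 d hdD
      obtain ⟨-, q, hq, hqd, hle⟩ := hdD
      have h2 : 2 ≤ C * d := hqd.two_le.trans hle
      have hN1 : (1 : ℝ) ≤ Nat.primeCounting (C * d) := by
        exact_mod_cast (one_le_primeCounting hqd).trans (Nat.monotone_primeCounting hle)
      have hL1 : 1 ≤ L (Nat.primeCounting (C * d)) := le_max_left _ _
      calc _ ≤ nint (d * α) := deltaMin_nthPrime_le hd1 hq hqd hle α
        _ ≤ c₁ * η d := hd.le
        _ ≤ η (5 * C * d) := hη₁ d hd1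
        _ ≤ _ := by
          refine hanti _ _ (Nat.le_floor ?_) (Nat.floor_le_of_le ?_)
          · rw [Nat.cast_one]
            exact one_le_mul_of_one_le_of_one_le hN1 hL1
          · refine (primeCounting_mul_L_le h2).trans_eq ?_
            push_cast
            ring
    refine le_antisymm ?_ ?_
    · calc _ ≤ volume (Set.Icc (0 : ℝ) 1) := measure_mono fun α hα => hα.1
        _ = 1 := by simp
    · calc (1 : ENNReal) = volume (Set.Ioc (0 : ℝ) 1) := by simp
        _ ≤ _ := measure_mono_ae hsub
  · by_cases hdD : d ∈ D
    · simpa only [Set.indicator_of_mem hdD] using hη₂ d (hD0 d hdD)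
    · simp only [Set.indicator_of_notMem hdD]
      norm_num
  · rw [summable_mul_left_iff hc₁.ne'] at h
    exact not_summable_indicator_of_le_card hη (fun n hn => hanti n (n + 1) hn (by omega)) hdiv
      hc₀ hD h
  · have hdD : d ∈ D := by
      by_contra hdD
      simp [Set.indicator_of_notMem hdD] at hd
    exact hdD.1
end
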